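/- Assume G ≅ C_{n1} ⊕ … ⊕ C_{nr} with 1 < n1 | … | nr and D(G) ≥ 4, and let G' be a finite abelian group with 𝓛(G) = 𝓛(G'). If r ≤ nr − 3, then exp(G) = exp(G') and r(G') ≤ nr − 3. -/

import Mathlib

/- Common definitions: zero-sum sequences over a finite abelian group,
   sets of lengths, the system of sets of lengths, the Davenport constant,
   sets of distances, elasticities, AAPs, Δ₁(G), ρ(G,d,k), ρ(G,d), ρ*(G,d),
   cross numbers, K(G₀), K(G,d), LCN-sets, Δ*(G). -/

open scoped Classical

section Defs

variable {G : Type*} [AddCommGroup G]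

/-- The support of a sequence (multiset) over `G`. -/
def suppSet (A : Multiset G) : Set G := {g | g ∈ A}

/-- `A` is a minimal zero-sum sequence (an atom of `𝓑(G₀)`) over `G₀ ⊆ G`:
a nontrivial zero-sum sequence with terms in `G₀` such that every proper
nontrivial subsequence has nonzero sum. -/
def IsMinZeroSum (G0 : Set G) (A : Multiset G) : Prop :=
  A ≠ 0 ∧ (∀ g ∈ A, g ∈ G0) ∧ A.sum = 0 ∧
    ∀ T : Multiset G, T ≤ A → T.sum = 0 → T = 0 ∨ T = A

/-- `B` is a zero-sum sequence over `G₀ ⊆ G` (an element of `𝓑(G₀)`). -/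
def IsZeroSumSeq (G0 : Set G) (B : Multiset G) : Prop :=
  (∀ g ∈ B, g ∈ G0) ∧ B.sum = 0

/-- The set of lengths `L(B)` of a zero-sum sequence `B` over `G₀`:
all `k` such that `B` is a product of `k` atoms of `𝓑(G₀)`.
(For the trivial sequence this is `{0}`.) -/
def lengthSet (G0 : Set G) (B : Multiset G) : Set ℕ :=
  {k | ∃ U : Fin k → Multiset G, (∀ i, IsMinZeroSum G0 (U i)) ∧ B = ∑ i, U i}

/-- The system of sets of lengths `𝓛(G₀)`. -/
def systemL (G0 : Set G) : Set (Set ℕ) :=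
  {L | ∃ B : Multiset G, IsZeroSumSeq G0 B ∧ L = lengthSet G0 B}

/-- The Davenport constant `D(G)`: the maximal length of a minimal zero-sum
sequence over `G`. -/
noncomputable def davenport (G : Type*) [AddCommGroup G] : ℕ :=
  sSup {m | ∃ A : Multiset G, IsMinZeroSum (Set.univ : Set G) A ∧ Multiset.card A = m}

/-- The set of successive distances `Δ(L)` of a set `L ⊆ ℕ`. -/
def deltaOf (L : Set ℕ) : Set ℕ :=
  {d | 0 < d ∧ ∃ a, a ∈ L ∧ a + d ∈ L ∧ ∀ c ∈ L, ¬(a < c ∧ c < a + d)}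

/-- `Δ(G₀) = ⋃_{L ∈ 𝓛(G₀)} Δ(L)`. -/
def deltaG0 (G0 : Set G) : Set ℕ := ⋃ L ∈ systemL G0, deltaOf L

/-- `Δ*(G) = {min Δ(G₀) : G₀ ⊆ G with Δ(G₀) ≠ ∅}`. -/
def deltaStar (G : Type*) [AddCommGroup G] : Set ℕ :=
  {d | ∃ G0 : Set G, deltaG0 G0 ≠ ∅ ∧ d = sInf (deltaG0 G0)}

/-- The elasticity `ρ(L) = max L / min L` of a (finite) set `L ⊆ ℕ`,
with the convention `ρ({0}) = 1`. -/
noncomputable def rhoL (L : Set ℕ) : ℝ :=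
  if sInf L = 0 then 1 else ((sSup L : ℕ) : ℝ) / ((sInf L : ℕ) : ℝ)

/-- The elasticity `ρ(G₀) = sup {ρ(L) : L ∈ 𝓛(G₀)}`. -/
noncomputable def rhoG0 (G0 : Set G) : ℝ := sSup (rhoL '' systemL G0)

/-- `L` (a set of naturals) is an almost arithmetical progression (AAP)
with difference `d`, length `ℓ` and bound `M`:
`L = y + (L' ∪ {0, d, …, ℓd} ∪ L'') ⊆ y + dℤ` with `L' ⊆ [−M, −1]` and
`L'' ⊆ ℓd + [1, M]`. -/
def IsAAP (L : Set ℕ) (d ℓ M : ℕ) : Prop :=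
  ∃ (y : ℤ) (L1 L2 : Set ℤ),
    L1 ⊆ Set.Icc (-(M : ℤ)) (-1) ∧
    L2 ⊆ Set.Icc ((ℓ : ℤ) * d + 1) ((ℓ : ℤ) * d + M) ∧
    ((fun x : ℕ => (x : ℤ)) '' L) =
      (fun x => y + x) '' (L1 ∪ (fun i : ℤ => (d : ℤ) * i) '' Set.Icc (0 : ℤ) (ℓ : ℤ) ∪ L2) ∧
    (∀ x ∈ L, (d : ℤ) ∣ ((x : ℤ) - y))

/-- `Δ₁(G)`: the set of `d ∈ ℕ` such that for every `k` there is some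
`L ∈ 𝓛(G)` which is an AAP with difference `d` and length at least `k`. -/
def delta1 (G : Type*) [AddCommGroup G] : Set ℕ :=
  {d | 0 < d ∧ ∀ k : ℕ, ∃ L ∈ systemL (Set.univ : Set G), ∃ ℓ ≥ k, ∃ M : ℕ, IsAAP L d ℓ M}

/-- `ρ(G, d, k)`: the supremum of elasticities of sets of lengths of `G` which
are AAPs with difference `d` and length at least `k`. -/
noncomputable def rhoGdk (G : Type*) [AddCommGroup G] (d k : ℕ) : ℝ :=
  sSup (rhoL '' {L | L ∈ systemL (Set.univ : Set G) ∧ ∃ ℓ ≥ k, ∃ M : ℕ, IsAAP L d ℓ M})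

/-- `ρ(G, d)`: the limit of the decreasing sequence `(ρ(G, d, k))_k`,
i.e. its infimum. -/
noncomputable def rhoGd (G : Type*) [AddCommGroup G] (d : ℕ) : ℝ :=
  ⨅ k : ℕ, rhoGdk G d k

/-- `ρ*(G, d) = max {ρ(G₀) : G₀ ⊆ G non-half-factorial with d ∣ min Δ(G₀)}`. -/
noncomputable def rhoStar (G : Type*) [AddCommGroup G] (d : ℕ) : ℝ :=
  sSup {x | ∃ G0 : Set G, deltaG0 G0 ≠ ∅ ∧ d ∣ sInf (deltaG0 G0) ∧ x = rhoG0 G0}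

/-- The cross number `k(S) = Σ_{g ∈ S} 1/ord(g)` of a sequence `S`. -/
noncomputable def crossNum (S : Multiset G) : ℝ :=
  (S.map (fun g => (1 : ℝ) / (addOrderOf g))).sum

/-- `K(G₀) = max {k(A) : A ∈ 𝓐(G₀)}`, the cross number of `G₀`. -/
noncomputable def KG0 (G0 : Set G) : ℝ :=
  sSup {x | ∃ A : Multiset G, IsMinZeroSum G0 A ∧ x = crossNum A}

/-- `K(G, d) = max {K(G₀) : G₀ ⊆ G non-half-factorial with d ∣ min Δ(G₀)}`. -/
noncomputable def KGd (G : Type*) [AddCommGroup G] (d : ℕ) : ℝ :=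
  sSup {x | ∃ G0 : Set G, deltaG0 G0 ≠ ∅ ∧ d ∣ sInf (deltaG0 G0) ∧ x = KG0 G0}

/-- `G₀` is an LCN-set: `k(A) ≥ 1` for every atom `A` of `𝓑(G₀)`. -/
def IsLCN (G0 : Set G) : Prop :=
  ∀ A : Multiset G, IsMinZeroSum G0 A → 1 ≤ crossNum A

end Defs

set_option linter.unusedSectionVars false

section Basics

variable {G : Type*} [AddCommGroup G]

/-- Atoms: minimal zero-sum sequences over the whole group. -/
def ZAtom (A : Multiset G) : Prop :=
  A ≠ 0 ∧ A.sum = 0 ∧ ∀ T : Multiset G, T ≤ A → T.sum = 0 → T = 0 ∨ T = A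

/-- A multiset of atoms. -/
def ZFac (s : Multiset (Multiset G)) : Prop := ∀ A ∈ s, ZAtom A

theorem isMin_univ_iff (A : Multiset G) : IsMinZeroSum (Set.univ : Set G) A ↔ ZAtom A := by
  simp [IsMinZeroSum, ZAtom]

theorem ZFac.add {s t : Multiset (Multiset G)} (hs : ZFac s) (ht : ZFac t) : ZFac (s + t) := by
  intro A hA
  rcases Multiset.mem_add.1 hA with h | h
  · exact hs A h
  · exact ht A h

theorem ZFac.zero : ZFac (0 : Multiset (Multiset G)) := by
  intro A hA; simp at hA

theorem ZFac.cons {A : Multiset G} {s : Multiset (Multiset G)} (hA : ZAtom A) (hs : ZFac s) :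
    ZFac (A ::ₘ s) := by
  intro B hB
  rcases Multiset.mem_cons.1 hB with h | h
  · exact h ▸ hA
  · exact hs B h

theorem ZFac.mono {s t : Multiset (Multiset G)} (h : s ≤ t) (ht : ZFac t) : ZFac s :=
  fun A hA => ht A (Multiset.mem_of_le h hA)

theorem ZFac.nsmul {s : Multiset (Multiset G)} (hs : ZFac s) (k : ℕ) : ZFac (k • s) := by
  intro A hA
  exact hs A (Multiset.mem_of_mem_nsmul hA)

theorem ZFac.replicate {A : Multiset G} (hA : ZAtom A) (k : ℕ) : ZFac (Multiset.replicate k A) := by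
  intro B hB
  exact (Multiset.eq_of_mem_replicate hB) ▸ hA

theorem ZFac.sum_sum {s : Multiset (Multiset G)} (hs : ZFac s) : s.sum.sum = 0 := by
  induction s using Multiset.induction_on with
  | empty => simp
  | cons A s ih =>
    rw [Multiset.sum_cons, Multiset.sum_add, (hs A (by simp)).2.1,
      ih (fun B hB => hs B (by simp [hB]))]
    simp

theorem ZFac.eq_zero_of_sum {s : Multiset (Multiset G)} (hs : ZFac s) (h : s.sum = 0) : s = 0 := by
  by_contra hne
  obtain ⟨A, hA⟩ := Multiset.exists_mem_of_ne_zero hne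
  have : A ≤ s.sum := Multiset.le_sum_of_mem hA
  rw [h] at this
  exact (hs A hA).1 (Multiset.le_zero.1 this)

theorem le_of_mem_fac {s : Multiset (Multiset G)} {A : Multiset G} (hA : A ∈ s) : A ≤ s.sum :=
  Multiset.le_sum_of_mem hA

theorem sum_sub_zero {A B : Multiset G} (h : A ≤ B) (hA : A.sum = 0) (hB : B.sum = 0) :
    (B - A).sum = 0 := by
  have : (B - A + A).sum = 0 := by rw [Multiset.sub_add_cancel h, hB]
  rw [Multiset.sum_add, hA, add_zero] at this
  exact this

theorem exists_fac (B : Multiset G) (hB : B.sum = 0) : ∃ s, ZFac s ∧ s.sum = B := by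
  induction B using Multiset.strongInductionOn with
  | ih B ih =>
    by_cases h0 : B = 0
    · exact ⟨0, ZFac.zero, by simp [h0]⟩
    by_cases hat : ZAtom B
    · exact ⟨{B}, by intro A hA; rw [Multiset.mem_singleton.1 hA]; exact hat, by simp⟩
    simp only [ZAtom, not_and, not_forall, not_or] at hat
    obtain ⟨T, hT, hT0, hTne, hTB⟩ := hat h0 hB
    have hlt : T < B := lt_of_le_of_ne hT hTB
    have hlt2 : B - T < B := by
      refine lt_of_le_of_ne tsub_le_self ?_
      intro he
      have h2 := Multiset.sub_add_cancel hT
      rw [he] at h2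
      exact hTne (by simpa using h2)
    obtain ⟨s, hs, hs2⟩ := ih T hlt hT0
    obtain ⟨t, ht, ht2⟩ := ih (B - T) hlt2 (sum_sub_zero hT hT0 hB)
    exact ⟨s + t, hs.add ht, by rw [Multiset.sum_add, hs2, ht2, add_comm]; exact Multiset.sub_add_cancel hT⟩

theorem mem_lengthSet_iff (B : Multiset G) (k : ℕ) :
    k ∈ lengthSet (Set.univ : Set G) B ↔ ∃ s, ZFac s ∧ s.sum = B ∧ s.card = k := by
  constructor
  · rintro ⟨U, hU, hB⟩
    refine ⟨Finset.univ.val.map U, ?_, ?_, by simp⟩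
    · intro A hA
      obtain ⟨i, -, rfl⟩ := Multiset.mem_map.1 hA
      exact (isMin_univ_iff _).1 (hU i)
    · rw [hB]; rfl
  · rintro ⟨s, hs, hB, hk⟩
    subst hk
    induction s using Quotient.inductionOn with
    | h l =>
      refine ⟨fun i => l.get (Fin.cast (by simp) i), ?_, ?_⟩
      · intro i
        rw [isMin_univ_iff]
        exact hs _ (by simp)
      · rw [← hB]
        simp only [Multiset.quot_mk_to_coe, Multiset.sum_coe, Multiset.coe_card]
        conv_lhs => rw [← List.ofFn_get l, List.sum_ofFn]
        rfl

theorem vertex_le_iff (g : G) (k : ℕ) (A : Multiset G) :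
    Multiset.replicate k g ≤ A ↔ k ≤ A.count g := Multiset.le_count_iff_replicate_le.symm

/-- The atom `g^{ord g}`. -/
noncomputable def vtx (g : G) : Multiset G := Multiset.replicate (addOrderOf g) g

theorem vtx_sum (g : G) : (vtx g).sum = 0 := by
  simp [vtx, addOrderOf_nsmul_eq_zero]

theorem vtx_atom [Finite G] (g : G) : ZAtom (vtx g) := by
  have ho : 0 < addOrderOf g := addOrderOf_pos g
  refine ⟨?_, vtx_sum g, ?_⟩
  · intro h
    have := congrArg Multiset.card h
    rw [vtx, Multiset.card_replicate, Multiset.card_zero] at this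
    omega
  · intro T hT hT0
    obtain ⟨k, hk, rfl⟩ := Multiset.le_replicate_iff.1 hT
    simp at hT0
    have hd := addOrderOf_dvd_of_nsmul_eq_zero hT0
    rcases Nat.eq_zero_or_pos k with h | h
    · left; simp [h]
    · right
      have := Nat.le_of_dvd h hd
      have : k = addOrderOf g := le_antisymm hk this
      rw [this]; rfl

theorem count_vtx (g h : G) : (vtx g).count h = if g = h then addOrderOf g else 0 := by
  simp [vtx, Multiset.count_replicate]

theorem mem_vtx [Finite G] {g h : G} : h ∈ vtx g ↔ h = g := by
  have ho : 0 < addOrderOf g := addOrderOf_pos g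
  simp [vtx, Multiset.mem_replicate, ho.ne']

theorem ZAtom.eq_vtx [Finite G] {A : Multiset G} (hA : ZAtom A) {g : G}
    (h : addOrderOf g ≤ A.count g) : A = vtx g := by
  have hle : vtx g ≤ A := (vertex_le_iff _ _ _).2 h
  rcases hA.2.2 _ hle (vtx_sum g) with h1 | h1
  · exact absurd h1 (vtx_atom g).1
  · exact h1.symm

theorem ZAtom.count_le [Finite G] {A : Multiset G} (hA : ZAtom A) (g : G) :
    A.count g ≤ addOrderOf g := by
  by_contra h
  have := hA.eq_vtx (g := g) (by omega)
  rw [this, count_vtx] at h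
  simp at h

theorem ZAtom.le_atom {A B : Multiset G} (hA : ZAtom A) (hB : ZAtom B) (h : A ≤ B) : A = B := by
  rcases hB.2.2 A h hA.2.1 with h1 | h1
  · exact absurd h1 hA.1
  · exact h1

theorem atoms_finite [Finite G] : {A : Multiset G | ZAtom A}.Finite := by
  have := Fintype.ofFinite G
  refine (Set.finite_Iic ((Fintype.card G) • (Finset.univ : Finset G).val)).subset ?_
  intro A hA
  simp only [Set.mem_Iic]
  rw [Multiset.le_iff_count]
  intro g
  rw [Multiset.count_nsmul]
  have h1 : (Finset.univ : Finset G).val.count g = 1 := by simp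
  rw [h1, mul_one]
  exact (ZAtom.count_le hA g).trans addOrderOf_le_card_univ

theorem atom_ne_zero_of_ne {A : Multiset G} (hA : ZAtom A) (h : A ≠ {0}) : (0 : G) ∉ A := by
  intro h0
  rcases hA.2.2 {0} (Multiset.singleton_le.2 h0) (by simp) with h1 | h1
  · simp at h1
  · exact h h1.symm

/-- Zero-sum lemma for families. -/
theorem exists_zero_subsum {ι A : Type*} [AddCommGroup A] [Finite A] (f : ι → A)
    (P : Multiset ι) (hP : Nat.card A ≤ P.card) : ∃ Q ≤ P, Q ≠ 0 ∧ (Q.map f).sum = 0 := by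
  induction P using Quotient.inductionOn with
  | h l =>
    simp only [Multiset.quot_mk_to_coe, Multiset.coe_card] at hP ⊢
    have hni : ¬ Function.Injective (fun i : Fin (l.length + 1) => ((l.take i).map f).sum) := by
      intro hinj
      have := Nat.card_le_card_of_injective _ hinj
      simp at this
      omega
    simp only [Function.Injective, not_forall] at hni
    have key : ∀ i j : Fin (l.length + 1), i < j → ((l.take i).map f).sum = ((l.take j).map f).sum →
        ∃ Q ≤ (l : Multiset ι), Q ≠ 0 ∧ (Q.map f).sum = 0 := by
      intro i j hij he
      refine ⟨(((l.take j).drop i : List ι) : Multiset ι), ?_, ?_, ?_⟩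
      · exact Multiset.coe_le.2 (((List.drop_sublist _ _).trans (List.take_sublist _ _)).subperm)
      · intro h0
        have := congrArg Multiset.card h0
        simp at this
        have hj := j.2
        have : (i : ℕ) < j := hij
        omega
      · have h1 : (l.take j) = (l.take i) ++ ((l.take j).drop i) := by
          conv_lhs => rw [← List.take_append_drop i (l.take j)]
          rw [List.take_take, min_eq_left (Fin.le_def.1 (le_of_lt hij))]
        rw [h1, List.map_append, List.sum_append] at he
        simpa using he
    obtain ⟨i, j, he, hne⟩ := hni
    rcases lt_or_gt_of_ne hne with h | h
    · exact key i j h he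
    · exact key j i h he.symm

/-- `n` times the cross number. -/
noncomputable def kN (n : ℕ) (S : Multiset G) : ℕ := (S.map (fun g => n / addOrderOf g)).sum

theorem kN_add (n : ℕ) (S T : Multiset G) : kN n (S + T) = kN n S + kN n T := by
  simp [kN]

theorem kN_zero (n : ℕ) : kN n (0 : Multiset G) = 0 := by simp [kN]

theorem kN_nsmul (n k : ℕ) (S : Multiset G) : kN n (k • S) = k * kN n S := by
  induction k with
  | zero => simp [kN]
  | succ k ih => rw [succ_nsmul, kN_add, ih]; ring

theorem kN_sum (n : ℕ) (s : Multiset (Multiset G)) : kN n s.sum = (s.map (kN n)).sum := by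
  induction s using Multiset.induction_on with
  | empty => simp [kN]
  | cons A s ih => simp [kN_add, ih]

theorem kN_vtx {n : ℕ} {g : G} (h : addOrderOf g ∣ n) : kN n (vtx g) = n := by
  simp [kN, vtx]
  exact Nat.mul_div_cancel' h

theorem kN_fac_ge {n : ℕ} {s : Multiset (Multiset G)} (h : ∀ A ∈ s, n ≤ kN n A) :
    n * s.card ≤ kN n s.sum := by
  induction s using Multiset.induction_on with
  | empty => simp
  | cons A s ih =>
    have h1 := h A (by simp)
    have h2 := ih (fun B hB => h B (by simp [hB]))
    rw [Multiset.sum_cons, kN_add, Multiset.card_cons]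
    nlinarith

theorem kN_fac_eq {n : ℕ} {s : Multiset (Multiset G)} (h : ∀ A ∈ s, kN n A = n) :
    kN n s.sum = n * s.card := by
  induction s using Multiset.induction_on with
  | empty => simp [kN]
  | cons A s ih =>
    have h1 := h A (by simp)
    have h2 := ih (fun B hB => h B (by simp [hB]))
    rw [Multiset.sum_cons, kN_add, Multiset.card_cons, h1, h2]
    ring

/-- All factorization lengths over `G0` are congruent mod `d`. -/
def HD (G0 : Set G) (d : ℕ) : Prop :=
  ∀ s t : Multiset (Multiset G), ZFac s → ZFac t → s.sum = t.sum → (∀ g ∈ s.sum, g ∈ G0) →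
    s.card ≡ t.card [MOD d]

theorem HD.mono {G0 G1 : Set G} {d : ℕ} (h : HD G1 d) (h01 : G0 ⊆ G1) : HD G0 d :=
  fun s t hs ht he hg => h s t hs ht he (fun g hg' => h01 (hg g hg'))

/-- Every multiset `n • A` is a product of vertices. -/
theorem nsmul_eq_vtx {n : ℕ} (A : Multiset G) (hA : ∀ g ∈ A, addOrderOf g ∣ n) [Finite G] :
    ∃ s, ZFac s ∧ s.sum = n • A ∧ s.card = kN n A := by
  induction A using Multiset.induction_on with
  | empty => exact ⟨0, ZFac.zero, by simp, by simp [kN]⟩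
  | cons g A ih =>
    obtain ⟨s, hs, hs2, hs3⟩ := ih (fun h hh => hA h (by simp [hh]))
    refine ⟨Multiset.replicate (n / addOrderOf g) (vtx g) + s, (ZFac.replicate (vtx_atom g) _).add hs, ?_, ?_⟩
    · rw [Multiset.sum_add, hs2, Multiset.sum_replicate, vtx, Multiset.nsmul_replicate,
        Nat.div_mul_cancel (hA g (by simp))]
      rw [← Multiset.singleton_add, nsmul_add, Multiset.nsmul_singleton]
    · simp [kN, hs3]

theorem HD.kN_mod [Finite G] {G0 : Set G} {d n : ℕ} (h : HD G0 d) {A : Multiset G} (hA : ZAtom A)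
    (hA0 : ∀ g ∈ A, g ∈ G0) (hn : ∀ g ∈ A, addOrderOf g ∣ n) : kN n A ≡ n [MOD d] := by
  obtain ⟨s, hs, hs2, hs3⟩ := nsmul_eq_vtx A hn
  have := h s (Multiset.replicate n A) hs (ZFac.replicate hA n) (by simp [hs2])
    (by rw [hs2]; intro g hg; exact hA0 g (Multiset.mem_of_mem_nsmul hg))
  simpa [hs3] using this

theorem kN_pos_of_mem [Finite G] {n : ℕ} (hn0 : 0 < n) {A : Multiset G}
    (hn : ∀ g ∈ A, addOrderOf g ∣ n) : A.card ≤ kN n A := by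
  induction A using Multiset.induction_on with
  | empty => simp
  | cons g A ih =>
    have := ih (fun h hh => hn h (by simp [hh]))
    have h1 : 0 < n / addOrderOf g :=
      Nat.div_pos (Nat.le_of_dvd hn0 (hn g (by simp))) (addOrderOf_pos g)
    simp [kN] at this ⊢
    omega

end Basics

section GroupPart

variable {G : Type*} [AddCommGroup G] [Finite G]

theorem closure_mset {E : Set G} {x : G} (hx : x ∈ AddSubgroup.closure E) :
    ∃ T : Multiset G, (∀ g ∈ T, g ∈ E) ∧ T.sum = x := by
  have h1 : x ∈ (AddSubgroup.closure E).toAddSubmonoid := hx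
  rw [AddSubgroup.closure_toAddSubmonoid_of_finite] at h1
  obtain ⟨T, hT, hT2⟩ := AddSubmonoid.exists_multiset_of_mem_closure h1
  exact ⟨T, hT, hT2⟩

theorem exists_complement {E : Set G} {h : G} {v : ℕ} (hx : v • h ∈ AddSubgroup.closure E) :
    ∃ T : Multiset G, (∀ g ∈ T, g ∈ E) ∧ (Multiset.replicate v h + T).sum = 0 := by
  obtain ⟨T, hT, hT2⟩ := closure_mset (neg_mem hx)
  exact ⟨T, hT, by simp [hT2]⟩

theorem split_count (h : G) (B : Multiset G) :
    B = Multiset.replicate (B.count h) h + B.filter (fun g => g ≠ h) := by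
  ext g
  rw [Multiset.count_add, Multiset.count_replicate, Multiset.count_filter]
  by_cases hg : g = h
  · simp [hg]
  · simp [hg, Ne.symm hg]

theorem order_dvd_count {E : Set G} {h : G} {B : Multiset G} (hB : B.sum = 0)
    (hE : ∀ g ∈ B, g = h ∨ g ∈ E) :
    addOrderOf (h : G ⧸ AddSubgroup.closure E) ∣ B.count h := by
  apply addOrderOf_dvd_of_nsmul_eq_zero
  rw [← QuotientAddGroup.mk_nsmul, QuotientAddGroup.eq_zero_iff]
  have h1 := split_count h B
  have h2 : (B.count h) • h = - (B.filter (fun g => g ≠ h)).sum := by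
    rw [eq_neg_iff_add_eq_zero]
    have := hB
    rw [h1, Multiset.sum_add, Multiset.sum_replicate] at this
    exact this
  rw [h2]
  apply neg_mem
  apply AddSubgroup.multiset_sum_mem
  intro g hg
  rw [Multiset.mem_filter] at hg
  exact AddSubgroup.subset_closure ((hE g hg.1).resolve_left hg.2)

theorem order_nsmul_mem (E : Set G) (h : G) :
    addOrderOf (h : G ⧸ AddSubgroup.closure E) • h ∈ AddSubgroup.closure E := by
  rw [← QuotientAddGroup.eq_zero_iff, QuotientAddGroup.mk_nsmul]
  exact addOrderOf_nsmul_eq_zero _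

theorem mem_closure_erase {E : Finset G} {h' x : G} (hx : x ∈ AddSubgroup.closure (E : Set G)) :
    ∃ a : ℤ, ∃ z ∈ AddSubgroup.closure ((E.erase h' : Finset G) : Set G), x = a • h' + z := by
  have hle : (E : Set G) ⊆ {h'} ∪ ((E.erase h' : Finset G) : Set G) := by
    intro y hy
    by_cases hyh : y = h'
    · left; exact hyh
    · right
      simp only [Finset.coe_erase, Set.mem_sdiff, Set.mem_singleton_iff]
      exact ⟨hy, hyh⟩
  have h2 := AddSubgroup.closure_mono hle hx
  rw [AddSubgroup.closure_union, AddSubgroup.mem_sup] at h2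
  obtain ⟨y, hy, z, hz, rfl⟩ := h2
  obtain ⟨a, rfl⟩ := AddSubgroup.mem_closure_singleton.1 hy
  exact ⟨a, z, hz, rfl⟩

theorem pigeon_prime (E : Finset G) (p r : ℕ) (hp : p.Prime)
    (hr : Nat.card {x : G // p • x = 0} ≤ p ^ r) (hE : r < E.card) :
    ∃ h' ∈ E, ∃ c : ℤ, ¬ (p : ℤ) ∣ c ∧ ∀ x ∈ AddSubgroup.closure (E : Set G),
      c • x ∈ AddSubgroup.closure ((E.erase h' : Finset G) : Set G) := by
  set H := AddSubgroup.closure (E : Set G) with hH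
  let φ : H →+ H := nsmulAddMonoidHom p
  have hcard : Nat.card (H ⧸ φ.range) ≤ p ^ r := by
    have h1 : Nat.card φ.ker * Nat.card φ.range = Nat.card H := by
      rw [← AddSubgroup.index_ker φ, AddSubgroup.card_mul_index]
    have h2 : Nat.card φ.range * φ.range.index = Nat.card H := AddSubgroup.card_mul_index _
    have h3 : Nat.card φ.ker ≤ Nat.card {x : G // p • x = 0} := by
      apply Nat.card_le_card_of_injective (fun x : φ.ker => (⟨(x : H), by
        have := x.2
        rw [AddMonoidHom.mem_ker] at this
        have h5 : p • (x : H) = 0 := this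
        have := congrArg (Subtype.val) h5
        simpa using this⟩ : {x : G // p • x = 0}))
      intro x y hxy
      simp only [Subtype.mk.injEq] at hxy
      exact Subtype.ext (Subtype.ext hxy)
    have h4 : 0 < Nat.card φ.range := Nat.card_pos
    have h5 : φ.range.index = Nat.card φ.ker := by
      apply Nat.eq_of_mul_eq_mul_left h4
      rw [h2, ← h1, mul_comm]
    change φ.range.index ≤ _
    rw [h5]; exact h3.trans hr
  let ψ : (E → Fin p) → H ⧸ φ.range := fun f =>
    ((∑ e : E, ((f e : ℕ)) • (⟨e, AddSubgroup.subset_closure e.2⟩ : H) : H) : H ⧸ φ.range)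
  have hni : ¬ Function.Injective ψ := by
    intro hinj
    have := Nat.card_le_card_of_injective _ hinj
    simp at this
    have h2 : p ^ r < p ^ E.card := Nat.pow_lt_pow_right hp.one_lt hE
    omega
  simp only [Function.Injective, not_forall] at hni
  obtain ⟨f, f', hff, hne⟩ := hni
  have : ∃ e, f e ≠ f' e := by
    by_contra hcon
    push Not at hcon
    exact hne (funext hcon)
  obtain ⟨e, he⟩ := this
  rw [QuotientAddGroup.eq] at hff
  obtain ⟨y, hy⟩ := hff
  have hy2 : p • (y : G) = ∑ e : E, (((f' e : ℕ) : ℤ) - ((f e : ℕ) : ℤ)) • (e : G) := by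
    have := congrArg Subtype.val hy
    simp only [φ, nsmulAddMonoidHom_apply, AddSubgroup.coe_nsmul, AddSubgroup.coe_add,
      AddSubgroup.coe_neg, AddSubgroup.val_finsetSum] at this
    rw [this]
    simp only [sub_smul, Finset.sum_sub_distrib, natCast_zsmul]
    abel
  rw [← Finset.add_sum_erase _ _ (Finset.mem_univ e)] at hy2
  obtain ⟨a, z, hz, hyz⟩ := mem_closure_erase (h' := (e : G)) y.2
  set c0 : ℤ := ((f' e : ℕ) : ℤ) - ((f e : ℕ) : ℤ) with hc0
  have hmem : (c0 - p * a) • (e : G) ∈ AddSubgroup.closure ((E.erase (e : G) : Finset G) : Set G) := by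
    have : (c0 - p * a) • (e : G) = p • z -
        ∑ x ∈ Finset.univ.erase e, (((f' x : ℕ) : ℤ) - ((f x : ℕ) : ℤ)) • (x : G) := by
      rw [hyz] at hy2
      rw [eq_sub_iff_add_eq, sub_smul, mul_smul, natCast_zsmul]
      rw [smul_add] at hy2
      rw [← sub_eq_zero] at hy2 ⊢
      rw [← neg_eq_zero, ← hy2]; abel
    rw [this]
    refine sub_mem (nsmul_mem hz _) (sum_mem ?_)
    intro x hx
    refine zsmul_mem (AddSubgroup.subset_closure ?_) _
    simp only [Finset.coe_erase, Set.mem_sdiff, Set.mem_singleton_iff]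
    exact ⟨x.2, fun hxe => (Finset.ne_of_mem_erase hx) (Subtype.ext hxe)⟩
  refine ⟨e, e.2, c0 - p * a, ?_, ?_⟩
  · intro hdiv
    have h1 : (p : ℤ) ∣ c0 := by
      have := dvd_add hdiv (Dvd.intro a rfl : (p : ℤ) ∣ p * a)
      simpa using this
    have h2 := Int.eq_zero_of_abs_lt_dvd h1 (by
      have := (f e).2; have := (f' e).2
      rw [hc0, abs_lt]; constructor <;> omega)
    apply he
    apply Fin.ext
    omega
  · intro x hx
    obtain ⟨b, w, hw, rfl⟩ := mem_closure_erase (h' := (e : G)) hx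
    rw [smul_add, smul_comm]
    exact add_mem (zsmul_mem hmem _) (zsmul_mem hw _)

theorem gen_mod (S : Set ℕ) (o m : ℕ) (ho : 0 < o) (hmo : m ∣ o)
    (hm : ∀ w ∈ S, m ∣ w) (hp : ∀ p : ℕ, p.Prime → p ∣ o / m → ∃ w ∈ S, ¬ p * m ∣ w)
    (v : ℕ) (hv : m ∣ v) : ∃ P : Multiset ℕ, (∀ w ∈ P, w ∈ S) ∧ P.sum ≡ v [MOD o] := by
  have hm0 : 0 < m := Nat.pos_of_dvd_of_pos hmo ho
  have : NeZero o := ⟨ho.ne'⟩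
  let K : AddSubgroup ℤ := AddSubgroup.closure (insert (o : ℤ) ((fun w : ℕ => (w : ℤ)) '' S))
  have hmK : (m : ℤ) ∈ K := by
    obtain ⟨t, ht⟩ := Int.subgroup_cyclic K
    have htdvd : ∀ x ∈ K, t ∣ x := by
      intro x hx
      rw [ht, AddSubgroup.mem_closure_singleton] at hx
      obtain ⟨a, rfl⟩ := hx
      exact Dvd.intro_left a (by simp)
    have hto : t ∣ (o : ℤ) := htdvd _ (AddSubgroup.subset_closure (by simp))
    have htw : ∀ w ∈ S, t ∣ (w : ℤ) := fun w hw => htdvd _ (AddSubgroup.subset_closure (by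
      right; exact ⟨w, hw, rfl⟩))
    have htK : t ∈ K := by rw [ht]; exact AddSubgroup.subset_closure (by simp)
    have hmt : (m : ℤ) ∣ t := by
      have hle : K ≤ AddSubgroup.zmultiples (m : ℤ) := by
        rw [AddSubgroup.closure_le]
        rintro x (rfl | ⟨w, hw, rfl⟩)
        · exact Int.mem_zmultiples_iff.2 (by exact_mod_cast hmo)
        · exact Int.mem_zmultiples_iff.2 (Int.natCast_dvd_natCast.2 (hm w hw))
      exact Int.mem_zmultiples_iff.1 (hle htK)
    obtain ⟨q, rfl⟩ := hmt
    by_cases hq : q.natAbs = 1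
    · rcases Int.natAbs_eq q with h | h <;> rw [hq] at h <;> subst h
      · simpa using htK
      · simpa using neg_mem htK
    · exfalso
      obtain ⟨p, hpp, hpq⟩ := Nat.exists_prime_and_dvd hq
      have hpq' : (p : ℤ) ∣ q := Int.natCast_dvd.2 hpq
      have hpm : ∀ x : ℕ, (m : ℤ) * q ∣ x → p * m ∣ x := by
        intro x hx
        have : ((p * m : ℕ) : ℤ) ∣ x := by
          push_cast
          rw [mul_comm]
          exact (mul_dvd_mul_left _ hpq').trans hx
        exact_mod_cast this
      have h1 : p ∣ o / m := by
        have := hpm o hto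
        rw [mul_comm] at this
        exact Nat.dvd_div_of_mul_dvd this
      obtain ⟨w, hw, hw2⟩ := hp p hpp h1
      exact hw2 (hpm w (htw w hw))
  have hvK : (v : ℤ) ∈ K := by
    obtain ⟨a, rfl⟩ := hv
    have := zsmul_mem hmK (a : ℤ)
    rw [smul_eq_mul] at this
    push_cast
    rw [mul_comm]; exact this
  let φ : ℤ →+ ZMod o := Int.castAddHom (ZMod o)
  have h2 : (v : ZMod o) ∈ AddSubgroup.closure ((fun w : ℕ => (w : ZMod o)) '' S) := by
    have h3 : φ v ∈ K.map φ := AddSubgroup.mem_map_of_mem _ hvK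
    rw [AddMonoidHom.map_closure] at h3
    have h4 : (φ '' insert (o : ℤ) ((fun w : ℕ => (w : ℤ)) '' S)) ⊆
        insert 0 ((fun w : ℕ => (w : ZMod o)) '' S) := by
      rintro x ⟨y, (rfl | ⟨w, hw, rfl⟩), rfl⟩
      · left; simp [φ]
      · right; exact ⟨w, hw, by simp [φ]⟩
    have h5 := AddSubgroup.closure_mono h4 h3
    rw [AddSubgroup.closure_insert_zero] at h5
    simpa [φ] using h5
  obtain ⟨T, hT, hT2⟩ := closure_mset h2
  have : ∃ P : Multiset ℕ, (∀ w ∈ P, w ∈ S) ∧ P.map (fun w : ℕ => (w : ZMod o)) = T := by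
    clear hT2
    induction T using Multiset.induction_on with
    | empty => exact ⟨0, by simp, by simp⟩
    | cons a T ih =>
      obtain ⟨P, hP, hP2⟩ := ih (fun g hg => hT g (by simp [hg]))
      obtain ⟨w, hw, hwa⟩ := hT a (by simp)
      refine ⟨w ::ₘ P, ?_, by simp [hP2]; exact hwa⟩
      intro x hx
      rcases Multiset.mem_cons.1 hx with h | h
      · exact h ▸ hw
      · exact hP x h
  obtain ⟨P, hP, hP2⟩ := this
  refine ⟨P, hP, ?_⟩
  rw [← ZMod.natCast_eq_natCast_iff, ← hT2, ← hP2]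
  simp

end GroupPart

section CorePart

variable {G : Type*} [AddCommGroup G] [Finite G]

/-- The situation inside the inductive step of the main lemma on LCN-sets. -/
structure Core (G0 : Finset G) (n d : ℕ) : Prop where
  hn : 0 < n
  hord : ∀ g ∈ G0, addOrderOf g ∣ n
  hd : 1 ≤ d
  hnd : n ≤ d + 3
  hHD : HD (G0 : Set G) d
  lcn : ∀ A, ZAtom A → (∀ g ∈ A, g ∈ G0) → n ≤ kN n A
  good : ∀ A, ZAtom A → (∀ g ∈ A, g ∈ G0) → ∀ g ∈ G0, g ∉ A → kN n A = n

/-- An atom over `G0` of cross number one. -/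
def GoodAtom (G0 : Finset G) (n : ℕ) (A : Multiset G) : Prop :=
  ZAtom A ∧ (∀ g ∈ A, g ∈ G0) ∧ kN n A = n

theorem count_msum (g : G) (s : Multiset (Multiset G)) :
    s.sum.count g = (s.map (fun A => A.count g)).sum := by
  induction s using Multiset.induction_on with
  | empty => simp
  | cons A s ih => simp [ih]

theorem over_of_mem {s : Multiset (Multiset G)} {B : Multiset G} (hs : s.sum = B) {P : G → Prop}
    (hB : ∀ g ∈ B, P g) : ∀ A ∈ s, ∀ g ∈ A, P g := by
  intro A hA g hg
  exact hB g (hs ▸ Multiset.mem_of_le (le_of_mem_fac hA) hg)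

theorem over_msum {s : Multiset (Multiset G)} {P : G → Prop} (h : ∀ A ∈ s, ∀ g ∈ A, P g) :
    ∀ g ∈ s.sum, P g := by
  induction s using Multiset.induction_on with
  | empty => simp
  | cons A s ih =>
    intro g hg
    rw [Multiset.sum_cons, Multiset.mem_add] at hg
    rcases hg with hg | hg
    · exact h A (by simp) g hg
    · exact ih (fun B hB => h B (by simp [hB])) g hg

theorem Core.fac_good {G0 : Finset G} {n d : ℕ} (hc : Core G0 n d) {C : Multiset G}
    (hC : ∀ g ∈ C, g ∈ G0) {h : G} (hh : h ∈ G0) (hhC : h ∉ C) {t : Multiset (Multiset G)}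
    (ht : ZFac t) (htC : t.sum = C) : ∀ A ∈ t, GoodAtom G0 n A := by
  intro A hA
  have h1 := over_of_mem htC hC A hA
  refine ⟨ht A hA, h1, hc.good A (ht A hA) h1 h hh ?_⟩
  intro hhA
  exact hhC (htC ▸ Multiset.mem_of_le (le_of_mem_fac hA) hhA)

theorem Core.prime_atom {G0 : Finset G} {n d : ℕ} (hc : Core G0 n d) {h : G}
    {p : ℕ} {h' : G} (hh' : h' ∈ G0.erase h) (hh : h ∈ G0) {c : ℤ} (hpc : ¬ (p : ℤ) ∣ c)
    (hcl : ∀ x ∈ AddSubgroup.closure ((G0.erase h : Finset G) : Set G),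
      c • x ∈ AddSubgroup.closure (((G0.erase h).erase h' : Finset G) : Set G)) :
    ∃ W, GoodAtom G0 n W ∧
      ¬ p * addOrderOf (h : G ⧸ AddSubgroup.closure ((G0.erase h : Finset G) : Set G)) ∣ W.count h := by
  set m := addOrderOf (h : G ⧸ AddSubgroup.closure ((G0.erase h : Finset G) : Set G)) with hm
  set E : Set G := (((G0.erase h).erase h' : Finset G) : Set G) with hE
  set m' := addOrderOf (h : G ⧸ AddSubgroup.closure E) with hm'
  have hm0 : 0 < m := addOrderOf_pos _
  obtain ⟨T, hT, hT0⟩ := exists_complement (order_nsmul_mem E h)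
  obtain ⟨s, hs, hs2⟩ := exists_fac _ hT0
  have hne : h ≠ h' := (Finset.ne_of_mem_erase hh').symm
  have hTE : ∀ g ∈ T, g ≠ h ∧ g ≠ h' ∧ g ∈ G0 := by
    intro g hg
    have := hT g hg
    rw [hE] at this
    simp at this
    tauto
  have hB : ∀ g ∈ Multiset.replicate m' h + T, g ∈ G0 := by
    intro g hg
    rcases Multiset.mem_add.1 hg with h1 | h1
    · rw [Multiset.eq_of_mem_replicate h1]; exact hh
    · exact (hTE g h1).2.2
  have hB' : h' ∉ Multiset.replicate m' h + T := by
    intro hg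
    rcases Multiset.mem_add.1 hg with h1 | h1
    · exact hne (Multiset.eq_of_mem_replicate h1).symm
    · exact (hTE _ h1).2.1 rfl
  have hgood := hc.fac_good hB (Finset.mem_of_mem_erase hh') hB' hs hs2
  by_contra hcon
  push Not at hcon
  have hdiv : p * m ∣ m' := by
    have h1 : (Multiset.replicate m' h + T).count h = m' := by
      rw [Multiset.count_add, Multiset.count_replicate_self, Multiset.count_eq_zero_of_notMem,
        add_zero]
      intro hhT; exact (hTE _ hhT).1 rfl
    rw [← h1, ← hs2, count_msum]
    apply Multiset.dvd_sum
    intro x hx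
    obtain ⟨A, hA, rfl⟩ := Multiset.mem_map.1 hx
    exact hcon A (hgood A hA)
  have hdiv2 : (m' : ℤ) ∣ c * m := by
    rw [hm', addOrderOf_dvd_iff_zsmul_eq_zero, ← QuotientAddGroup.mk_zsmul,
      QuotientAddGroup.eq_zero_iff, mul_smul, natCast_zsmul]
    exact hcl _ (order_nsmul_mem _ _)
  have h3 : ((p * m : ℕ) : ℤ) ∣ c * m := (Int.natCast_dvd_natCast.2 hdiv).trans hdiv2
  push_cast at h3
  exact hpc (Int.dvd_of_mul_dvd_mul_right (by exact_mod_cast hm0.ne') h3)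

theorem lift_multiset {α : Type*} (P : α → Prop) (f : α → ℕ) (T : Multiset ℕ)
    (hT : ∀ w ∈ T, ∃ a, P a ∧ f a = w) : ∃ S : Multiset α, (∀ a ∈ S, P a) ∧ S.map f = T := by
  induction T using Multiset.induction_on with
  | empty => exact ⟨0, by simp, by simp⟩
  | cons w T ih =>
    obtain ⟨S, hS, hS2⟩ := ih (fun g hg => hT g (by simp [hg]))
    obtain ⟨a, ha, haw⟩ := hT w (by simp)
    refine ⟨a ::ₘ S, ?_, by simp [hS2, haw]⟩
    intro x hx
    rcases Multiset.mem_cons.1 hx with h | h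
    · exact h ▸ ha
    · exact hS x h

/-- The hypothesis delivered by the pigeonhole argument. -/
def PigeonHyp (G0 : Finset G) (h : G) : Prop :=
  ∀ p : ℕ, p.Prime → ∃ h' ∈ G0.erase h, ∃ c : ℤ, ¬ (p : ℤ) ∣ c ∧
    ∀ x ∈ AddSubgroup.closure ((G0.erase h : Finset G) : Set G),
      c • x ∈ AddSubgroup.closure (((G0.erase h).erase h' : Finset G) : Set G)

theorem Core.dvd_count {G0 : Finset G} {h : G} {B : Multiset G} (hB : B.sum = 0)
    (hB0 : ∀ g ∈ B, g ∈ G0) :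
    addOrderOf (h : G ⧸ AddSubgroup.closure ((G0.erase h : Finset G) : Set G)) ∣ B.count h := by
  apply order_dvd_count hB
  intro g hg
  by_cases hgh : g = h
  · left; exact hgh
  · right; simp [hgh, hB0 g hg]

theorem Core.good_vtx {G0 : Finset G} {n d : ℕ} (hc : Core G0 n d) {h : G} (hh : h ∈ G0) :
    GoodAtom G0 n (vtx h) :=
  ⟨vtx_atom h, fun g hg => by rw [mem_vtx.1 hg]; exact hh, kN_vtx (hc.hord h hh)⟩

theorem Core.exists_mod {G0 : Finset G} {n d : ℕ} (hc : Core G0 n d) {h : G} (hh : h ∈ G0)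
    (hpig : PigeonHyp G0 h) (v : ℕ)
    (hv : addOrderOf (h : G ⧸ AddSubgroup.closure ((G0.erase h : Finset G) : Set G)) ∣ v) :
    ∃ P : Multiset (Multiset G), (∀ A ∈ P, GoodAtom G0 n A) ∧
      P.sum.count h ≡ v [MOD (addOrderOf h)] := by
  have hcv : (vtx h).count h = addOrderOf h := by simp [count_vtx]
  have hmo : addOrderOf (h : G ⧸ AddSubgroup.closure ((G0.erase h : Finset G) : Set G)) ∣
      addOrderOf h := by
    have := Core.dvd_count (G0 := G0) (h := h) (vtx_sum h) (hc.good_vtx hh).2.1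
    rwa [hcv] at this
  obtain ⟨T, hT, hT2⟩ := gen_mod {w | ∃ A, GoodAtom G0 n A ∧ A.count h = w} (addOrderOf h) _
    (addOrderOf_pos h) hmo
    (by rintro w ⟨A, hA, rfl⟩; exact Core.dvd_count hA.1.2.1 hA.2.1)
    (by
      intro p hp _
      obtain ⟨h', hh', c, hpc, hcl⟩ := hpig p hp
      obtain ⟨W, hW, hW2⟩ := hc.prime_atom hh' hh hpc hcl
      exact ⟨_, ⟨W, hW, rfl⟩, hW2⟩) v hv
  obtain ⟨S, hS, hS2⟩ := lift_multiset _ _ T hT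
  exact ⟨S, hS, by rw [count_msum, hS2]; exact hT2⟩

theorem goodFac {G0 : Finset G} {n : ℕ} {P : Multiset (Multiset G)}
    (hP : ∀ A ∈ P, GoodAtom G0 n A) : ZFac P ∧ (∀ g ∈ P.sum, g ∈ G0) ∧ kN n P.sum = n * P.card :=
  ⟨fun A hA => (hP A hA).1, over_msum (fun A hA => (hP A hA).2.1),
    kN_fac_eq (fun A hA => (hP A hA).2.2)⟩

theorem nsmul_vtx_le {h : G} {j : ℕ} {B : Multiset G} (hB : j * addOrderOf h ≤ B.count h) :
    j • vtx h ≤ B := by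
  rw [vtx, Multiset.nsmul_replicate]
  exact (vertex_le_iff _ _ _).2 hB

theorem nsmul_vtx_sum (h : G) (j : ℕ) : (j • vtx h).sum = 0 := by
  rw [Multiset.sum_nsmul, vtx_sum, smul_zero]

theorem Core.kN_mul {G0 : Finset G} {n d : ℕ} (hc : Core G0 n d) {h : G} (hh : h ∈ G0)
    (hpig : PigeonHyp G0 h) {A : Multiset G} (hA : ZAtom A) (hA0 : ∀ g ∈ A, g ∈ G0) :
    ∃ k, kN n A = n * k ∧ 1 ≤ k ∧ k ≡ 1 [MOD d] := by
  have ho : 0 < addOrderOf h := addOrderOf_pos h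
  obtain ⟨P, hP, hPc⟩ := hc.exists_mod hh hpig ((addOrderOf h - 1) * A.count h)
    (Dvd.dvd.mul_left (Core.dvd_count hA.2.1 hA0) _)
  obtain ⟨hPf, hP0, hPk⟩ := goodFac hP
  have hB : addOrderOf h ∣ (A + P.sum).count h := by
    rw [Multiset.count_add, ← Nat.modEq_zero_iff_dvd]
    have h1 : A.count h + P.sum.count h ≡ A.count h + (addOrderOf h - 1) * A.count h
        [MOD (addOrderOf h)] := Nat.ModEq.add_left _ hPc
    refine h1.trans ?_
    have h2 : A.count h + (addOrderOf h - 1) * A.count h = addOrderOf h * A.count h := by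
      obtain ⟨q, hq⟩ : ∃ q, addOrderOf h = q + 1 := ⟨addOrderOf h - 1, by omega⟩
      rw [hq]; simp; ring
    rw [h2, Nat.modEq_zero_iff_dvd]
    exact Dvd.intro _ rfl
  obtain ⟨j, hj⟩ := hB
  have hle : j • vtx h ≤ A + P.sum := nsmul_vtx_le (by rw [hj, mul_comm])
  set C := A + P.sum - j • vtx h with hC
  have hsum : C + j • vtx h = A + P.sum := Multiset.sub_add_cancel hle
  have hC0 : C.sum = 0 := sum_sub_zero hle (nsmul_vtx_sum h j)
    (by rw [Multiset.sum_add, hA.2.1, hPf.sum_sum, add_zero])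
  have hov : ∀ g ∈ A + P.sum, g ∈ G0 := by
    intro g hg
    rcases Multiset.mem_add.1 hg with h1 | h1
    · exact hA0 g h1
    · exact hP0 g h1
  have hCov : ∀ g ∈ C, g ∈ G0 := fun g hg => hov g (Multiset.mem_of_le tsub_le_self hg)
  have hCh : h ∉ C := by
    rw [← Multiset.count_eq_zero]
    have := congrArg (Multiset.count h) hsum
    rw [Multiset.count_add, hj, Multiset.count_nsmul, count_vtx, if_pos rfl, mul_comm] at this
    omega
  obtain ⟨t, ht, htC⟩ := exists_fac C hC0
  obtain ⟨-, -, htk⟩ := goodFac (hc.fac_good hCov hh hCh ht htC)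
  have hlen := hc.hHD (A ::ₘ P) (t + Multiset.replicate j (vtx h)) (ZFac.cons hA hPf)
    (ht.add (ZFac.replicate (vtx_atom h) j)) (by simp [htC, hsum]) (by simpa using hov)
  have hk := congrArg (kN n) hsum
  rw [kN_add, kN_add, kN_nsmul, kN_vtx (hc.hord h hh), hPk, ← htC, htk] at hk
  have hl := hc.lcn A hA hA0
  have hn := hc.hn
  have hge : P.card + 1 ≤ t.card + j := by
    by_contra hcon
    have : t.card + j ≤ P.card := by omega
    have h2 : n * (t.card + j) ≤ n * P.card := Nat.mul_le_mul_left _ this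
    nlinarith
  refine ⟨t.card + j - P.card, ?_, by omega, ?_⟩
  · rw [Nat.mul_sub, mul_add]
    rw [mul_comm j n] at hk
    omega
  · apply Nat.ModEq.add_right_cancel' P.card
    rw [Nat.sub_add_cancel (by omega)]
    simp only [Multiset.card_cons, Multiset.card_add, Multiset.card_replicate] at hlen
    rw [add_comm 1]
    exact hlen.symm

theorem Core.exists_unit_atom {G0 : Finset G} {n d : ℕ} (hc : Core G0 n d) {h : G} (hh : h ∈ G0)
    (hpig : PigeonHyp G0 h)
    (hlt : addOrderOf (h : G ⧸ AddSubgroup.closure ((G0.erase h : Finset G) : Set G)) <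
      addOrderOf h) :
    ∃ W, GoodAtom G0 n W ∧ W.count h =
      addOrderOf (h : G ⧸ AddSubgroup.closure ((G0.erase h : Finset G) : Set G)) := by
  have ho : 0 < addOrderOf h := addOrderOf_pos h
  have hdc := fun (B : Multiset G) (hB : B.sum = 0) (hB0 : ∀ g ∈ B, g ∈ G0) =>
    Core.dvd_count (h := h) hB hB0
  have hmod := hc.exists_mod hh hpig
  have hm0 : 0 < addOrderOf (h : G ⧸ AddSubgroup.closure ((G0.erase h : Finset G) : Set G)) :=
    addOrderOf_pos _
  generalize addOrderOf (h : G ⧸ AddSubgroup.closure ((G0.erase h : Finset G) : Set G)) = m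
    at hlt hdc hmod hm0 ⊢
  have hex : ∃ k, ∃ P : Multiset (Multiset G), P.card = k ∧ (∀ A ∈ P, GoodAtom G0 n A) ∧
      P.sum.count h ≡ m [MOD (addOrderOf h)] := by
    obtain ⟨P, hP, hP2⟩ := hmod m dvd_rfl
    exact ⟨_, P, rfl, hP, hP2⟩
  obtain ⟨P, hPk, hP, hPm⟩ := Nat.find_spec hex
  have hmin : ∀ Q : Multiset (Multiset G), (∀ A ∈ Q, GoodAtom G0 n A) →
      Q.sum.count h ≡ m [MOD (addOrderOf h)] → P.card ≤ Q.card := by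
    intro Q hQ hQ2
    rw [hPk]
    exact Nat.find_min' hex ⟨Q, rfl, hQ, hQ2⟩
  clear hPk
  by_contra hcon
  push Not at hcon
  have hnosub : ∀ Q ≤ P, Q ≠ 0 → ¬ addOrderOf h ∣ Q.sum.count h := by
    intro Q hQ hQ0 hdv
    have h1 := hmin (P - Q) (fun A hA => hP A (Multiset.mem_of_le tsub_le_self hA)) (by
      have h2 : P.sum.count h = (P - Q).sum.count h + Q.sum.count h := by
        rw [← Multiset.count_add, ← Multiset.sum_add, Multiset.sub_add_cancel hQ]
      rw [h2] at hPm
      have h3 : Q.sum.count h ≡ 0 [MOD (addOrderOf h)] := Nat.modEq_zero_iff_dvd.2 hdv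
      have h4 := (Nat.ModEq.add_left ((P - Q).sum.count h) h3).symm
      rw [add_zero] at h4
      exact h4.trans hPm)
    rw [Multiset.card_sub hQ] at h1
    have h2 := Multiset.card_le_card hQ
    have h3 : 0 < Q.card := Multiset.card_pos.2 hQ0
    omega
  have hcard : P.card < addOrderOf h := by
    by_contra hge
    have : NeZero (addOrderOf h) := ⟨ho.ne'⟩
    obtain ⟨Q, hQ, hQ0, hQs⟩ := exists_zero_subsum
      (fun A : Multiset G => ((A.count h : ℕ) : ZMod (addOrderOf h))) P (by simpa using hge)
    apply hnosub Q hQ hQ0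
    rw [count_msum, ← ZMod.natCast_eq_zero_iff, ← hQs]
    simp
  have hcnt : ∀ A ∈ P, 2 * m ≤ A.count h := by
    intro A hA
    obtain ⟨q, hq⟩ := hdc A (hP A hA).1.2.1 (hP A hA).2.1
    have h1 := hnosub {A} (Multiset.singleton_le.2 hA) (by simp)
    have h2 := hcon A (hP A hA)
    simp only [Multiset.sum_singleton] at h1
    rcases Nat.lt_or_ge q 2 with h3 | h3
    · exfalso
      interval_cases q
      · simp [hq] at h1
      · simp [hq] at h2
    · rw [hq]; nlinarith
  have hsumge : 2 * m * P.card ≤ P.sum.count h := by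
    rw [count_msum]
    have : ∀ x ∈ P.map (fun A => A.count h), 2 * m ≤ x := by
      intro x hx
      obtain ⟨A, hA, rfl⟩ := Multiset.mem_map.1 hx
      exact hcnt A hA
    have h2 := Multiset.card_nsmul_le_sum this
    simp at h2
    linarith
  have hPne : 0 < P.card := by
    rw [Multiset.card_pos]
    rintro rfl
    simp at hPm
    have := (Nat.modEq_zero_iff_dvd.1 hPm.symm)
    have := Nat.le_of_dvd hm0 this
    omega
  have hmle : m < P.sum.count h := by nlinarith
  obtain ⟨j, hj⟩ := (Nat.modEq_iff_dvd' hmle.le).1 hPm.symm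
  have hjeq : P.sum.count h = m + addOrderOf h * j := by omega
  have hj1 : 1 ≤ j := by
    rcases Nat.eq_zero_or_pos j with h | h
    · subst h; omega
    · exact h
  have hPd : P.card ≤ d + j := by
    have hon : addOrderOf h ≤ n := Nat.le_of_dvd hc.hn (hc.hord h hh)
    have hnd := hc.hnd
    have hd := hc.hd
    rcases Nat.lt_or_ge j 2 with h2 | h2
    · have : j = 1 := by omega
      subst this
      rw [hjeq] at hsumge
      have h3 : m * (2 * P.card) ≤ m * (1 + addOrderOf h) := by nlinarith
      have h4 := Nat.le_of_mul_le_mul_left h3 hm0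
      omega
    · omega
  obtain ⟨hPf, hP0, hPkN⟩ := goodFac hP
  have hle : j • vtx h ≤ P.sum := nsmul_vtx_le (by rw [hjeq, mul_comm]; omega)
  have hB0 : (P.sum - j • vtx h).sum = 0 := sum_sub_zero hle (nsmul_vtx_sum h j) hPf.sum_sum
  have hadd : P.sum - j • vtx h + j • vtx h = P.sum := Multiset.sub_add_cancel hle
  set B := P.sum - j • vtx h with hB
  have hBov : ∀ g ∈ B, g ∈ G0 := fun g hg => hP0 g (Multiset.mem_of_le tsub_le_self hg)
  have hBc : B.count h = m := by
    have := congrArg (Multiset.count h) hadd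
    rw [Multiset.count_add, Multiset.count_nsmul, count_vtx, if_pos rfl, hjeq, mul_comm] at this
    omega
  obtain ⟨s, hs, hsB⟩ := exists_fac B hB0
  have hW : ∃ W ∈ s, W.count h ≠ 0 := by
    by_contra hall
    push Not at hall
    have : B.count h = 0 := by
      rw [← hsB, count_msum]
      apply Multiset.sum_eq_zero
      intro x hx
      obtain ⟨A, hA, rfl⟩ := Multiset.mem_map.1 hx
      exact hall A hA
    omega
  obtain ⟨W, hWs, hW0⟩ := hW
  have hWB : W ≤ B := hsB ▸ le_of_mem_fac hWs
  have hWov : ∀ g ∈ W, g ∈ G0 := fun g hg => hBov g (Multiset.mem_of_le hWB hg)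
  have hWc : W.count h = m := by
    have h1 := Multiset.count_le_of_le h hWB
    have h2 := Nat.le_of_dvd (Nat.pos_of_ne_zero hW0) (hdc W (hs W hWs).2.1 hWov)
    omega
  obtain ⟨k, hk, hk1, hkd⟩ := hc.kN_mul hh hpig (hs W hWs) hWov
  have hkle : k + j ≤ P.card := by
    have h1 := congrArg (kN n) hadd
    rw [kN_add, kN_nsmul, kN_vtx (hc.hord h hh), hPkN] at h1
    have h2 : kN n W ≤ kN n B := by
      have : B = W + (B - W) := by rw [add_comm]; exact (Multiset.sub_add_cancel hWB).symm
      rw [this, kN_add]; omega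
    have h3 : n * (k + j) ≤ n * P.card := by nlinarith
    exact Nat.le_of_mul_le_mul_left h3 hc.hn
  have hkk : k = 1 := by
    have h1 := (Nat.modEq_iff_dvd' hk1).1 hkd.symm
    rcases Nat.eq_zero_or_pos (k - 1) with h2 | h2
    · omega
    · have := Nat.le_of_dvd h2 h1
      omega
  exact hcon W ⟨hs W hWs, hWov, by rw [hk, hkk, mul_one]⟩ hWc

end CorePart

section MainLCN

variable {G : Type*} [AddCommGroup G] [Finite G]

theorem comb_select {ι : Type*} (f : ι → ℕ) (s : Multiset ι) (o d : ℕ) (hd : 1 ≤ d)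
    (hod : o ≤ d + 3) (hs : o ≤ (s.map f).sum) :
    ∃ I ≤ s, (I.map f).sum = o ∨ (o ≤ (I.map f).sum ∧ I.card ≤ d + 1) := by
  have hex : ∃ k, ∃ I ≤ s, I.card = k ∧ o ≤ (I.map f).sum := ⟨_, s, le_rfl, rfl, hs⟩
  obtain ⟨I, hIs, hIk, hIo⟩ := Nat.find_spec hex
  have hmin : ∀ J ≤ s, o ≤ (J.map f).sum → I.card ≤ J.card := by
    intro J hJ hJo
    rw [hIk]
    exact Nat.find_min' hex ⟨J, hJ, rfl, hJo⟩
  clear hIk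
  refine ⟨I, hIs, ?_⟩
  by_contra hcon
  push Not at hcon
  have hc := hcon.2 hIo
  have hne := hcon.1
  have herase : ∀ a ∈ I, ((I.erase a).map f).sum < o ∧ 2 ≤ f a := by
    intro a ha
    have h1 : ((I.erase a).map f).sum < o := by
      by_contra hge
      have := hmin (I.erase a) ((Multiset.erase_le a I).trans hIs) (by omega)
      have h2 := Multiset.card_erase_add_one ha
      omega
    have h2 : f a + ((I.erase a).map f).sum = (I.map f).sum := Multiset.sum_map_erase ha
    exact ⟨h1, by omega⟩
  obtain ⟨a, ha⟩ := Multiset.card_pos_iff_exists_mem.1 (show 0 < I.card by omega)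
  have h1 := (herase a ha).1
  have h2 := Multiset.card_erase_add_one ha
  have h3 : ∀ x ∈ (I.erase a).map f, 2 ≤ x := by
    intro x hx
    obtain ⟨b, hb, rfl⟩ := Multiset.mem_map.1 hx
    exact (herase b (Multiset.mem_of_mem_erase hb)).2
  have h4 := Multiset.card_nsmul_le_sum h3
  simp only [Multiset.card_map, smul_eq_mul] at h4
  omega

theorem fac_of_atom {A : Multiset G} (hA : ZAtom A) {s : Multiset (Multiset G)} (hs : ZFac s)
    (hsum : s.sum = A) : s = {A} := by
  have hne : s ≠ 0 := by
    rintro rfl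
    exact hA.1 (by simpa using hsum.symm)
  obtain ⟨B, hB⟩ := Multiset.exists_mem_of_ne_zero hne
  have hBA : B = A := (hs B hB).le_atom hA (hsum ▸ le_of_mem_fac hB)
  subst hBA
  obtain ⟨t, rfl⟩ := Multiset.exists_cons_of_mem hB
  rw [Multiset.sum_cons] at hsum
  have h0 : t.sum = 0 := by simpa using hsum
  have := (hs.mono (Multiset.le_cons_self t B)).eq_zero_of_sum h0
  simp [this]

theorem Core.step {G0 : Finset G} {n d : ℕ} (hc : Core G0 n d) {F : Multiset G}
    (hF : ∀ g ∈ F, g ∈ G0) {N : ℕ} (hN : ∀ s, ZFac s → s.sum = F → s.card ≤ N) {e : G}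
    (he : e ∈ G0) : ∀ s, ZFac s → s.sum = F + vtx e → s.card ≤ N + 1 := by
  intro s hs hsum
  by_contra hcon
  have hcnt : addOrderOf e ≤ (s.map (fun A => A.count e)).sum := by
    rw [← count_msum, hsum, Multiset.count_add, count_vtx, if_pos rfl]
    omega
  have hon : addOrderOf e ≤ n := Nat.le_of_dvd hc.hn (hc.hord e he)
  obtain ⟨I, hIs, hI⟩ := comb_select _ s (addOrderOf e) d hc.hd (hon.trans hc.hnd) hcnt
  have hIge : addOrderOf e ≤ I.sum.count e := by
    rw [count_msum]
    rcases hI with h | h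
    · exact h.ge
    · exact h.1
  rw [← count_msum] at hI
  have hle : vtx e ≤ I.sum := (vertex_le_iff _ _ _).2 hIge
  have hIf : ZFac I := hs.mono hIs
  have hadd : I.sum - vtx e + vtx e = I.sum := Multiset.sub_add_cancel hle
  have hY0 := sum_sub_zero hle (vtx_sum e) hIf.sum_sum
  set Y := I.sum - vtx e with hY
  obtain ⟨y, hy, hyY⟩ := exists_fac Y hY0
  have hsI : (s - I).sum + I.sum = s.sum := by
    rw [← Multiset.sum_add, Multiset.sub_add_cancel hIs]
  have hFeq : (y + (s - I)).sum = F := by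
    have : (y + (s - I)).sum + vtx e = F + vtx e := by
      rw [Multiset.sum_add, hyY, ← hsum, ← hsI, ← hadd]
      abel
    exact add_right_cancel this
  have hlen := hN _ (hy.add (hs.mono tsub_le_self)) hFeq
  rw [Multiset.card_add, Multiset.card_sub hIs] at hlen
  have hIc := Multiset.card_le_card hIs
  have hy2 : y.card + 2 ≤ I.card := by omega
  have hIov : ∀ g ∈ I.sum, g ∈ G0 := by
    have : ∀ g ∈ s.sum, g ∈ G0 := by
      rw [hsum]
      intro g hg
      rcases Multiset.mem_add.1 hg with h | h
      · exact hF g h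
      · rw [mem_vtx.1 h]; exact he
    intro g hg
    exact this g (hsI ▸ Multiset.mem_add.2 (Or.inr hg))
  have hypos : 0 < y.card := by
    rw [Multiset.card_pos]
    rintro rfl
    rw [← hyY] at hadd
    simp at hadd
    have := fac_of_atom (vtx_atom e) hIf hadd.symm
    rw [this] at hy2
    simp at hy2
  rcases hI with h | h
  · have hYov : ∀ g ∈ Y, g ∈ G0 := fun g hg => hIov g (Multiset.mem_of_le tsub_le_self hg)
    have hYe : e ∉ Y := by
      rw [← Multiset.count_eq_zero]
      have := congrArg (Multiset.count e) hadd
      rw [Multiset.count_add, count_vtx, if_pos rfl, h] at this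
      omega
    obtain ⟨-, -, hyk⟩ := goodFac (hc.fac_good hYov he hYe hy hyY)
    have h1 := congrArg (kN n) hadd
    rw [kN_add, kN_vtx (hc.hord e he), ← hyY, hyk] at h1
    have h2 := kN_fac_ge (n := n) (s := I) (fun A hA => hc.lcn A (hIf A hA)
      (over_of_mem rfl hIov A hA))
    rw [← h1] at h2
    have h3 : n * I.card ≤ n * (y.card + 1) := by linarith
    have := Nat.le_of_mul_le_mul_left h3 hc.hn
    omega
  · have h1 := hc.hHD I (vtx e ::ₘ y) hIf (ZFac.cons (vtx_atom e) hy)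
      (by rw [Multiset.sum_cons, hyY, add_comm, hadd]) hIov
    rw [Multiset.card_cons] at h1
    have h2 := (Nat.modEq_iff_dvd' (by omega)).1 h1.symm
    have h3 := Nat.le_of_dvd (by omega) h2
    omega

theorem atoms_over_finite (P : Multiset G → Prop) : {A : Multiset G | ZAtom A ∧ P A}.Finite :=
  atoms_finite.subset (fun _ hA => hA.1)

theorem Core.no_bad {G0 : Finset G} {n d : ℕ} (hc : Core G0 n d) {h : G} (hh : h ∈ G0)
    {W : Multiset G} (hW : GoodAtom G0 n W) (hWh : 0 < W.count h)
    (hWle : ∀ A, ZAtom A → (∀ g ∈ A, g ∈ G0) → kN n A ≠ n → W.count h ≤ A.count h) :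
    ∀ A, ZAtom A → (∀ g ∈ A, g ∈ G0) → kN n A = n := by
  by_contra hcon
  push Not at hcon
  obtain ⟨A1, hA1, hA1o, hA1k⟩ := hcon
  obtain ⟨A0, ⟨hA0, hA0o, hA0k⟩, hmax⟩ := Set.exists_max_image
    {A : Multiset G | ZAtom A ∧ ((∀ g ∈ A, g ∈ G0) ∧ kN n A ≠ n)}
    (fun A => (((kN n A : ℚ) - n) / (A.count h : ℚ))) (atoms_over_finite _)
    ⟨A1, hA1, hA1o, hA1k⟩
  have hv0 : 0 < A0.count h := lt_of_lt_of_le hWh (hWle A0 hA0 hA0o hA0k)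
  have hslope : ∀ A, ZAtom A → (∀ g ∈ A, g ∈ G0) →
      ((kN n A : ℤ) - n) * (A0.count h) ≤ ((kN n A0 : ℤ) - n) * (A.count h) := by
    intro A hA hAo
    by_cases hk : kN n A = n
    · have h1 := hc.lcn A0 hA0 hA0o
      rw [hk]
      have h2 : (0 : ℤ) ≤ (kN n A0 : ℤ) - n := by omega
      have h3 : (0 : ℤ) ≤ (A.count h : ℤ) := by positivity
      simpa using mul_nonneg h2 h3
    · have h1 := hmax A ⟨hA, hAo, hk⟩
      have hv : 0 < A.count h := lt_of_lt_of_le hWh (hWle A hA hAo hk)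
      have hv' : (0 : ℚ) < (A.count h : ℚ) := by exact_mod_cast hv
      have hv0' : (0 : ℚ) < (A0.count h : ℚ) := by exact_mod_cast hv0
      have h2 := (div_le_div_iff₀ hv' hv0').1 h1
      exact_mod_cast h2
  -- growth
  have hgrow : ∀ J : Finset G, J ⊆ G0 → ∀ s, ZFac s → s.sum = A0 + ∑ e ∈ J, vtx e →
      s.card ≤ J.card + 1 := by
    intro J
    induction J using Finset.induction_on with
    | empty =>
      intro _ s hs hsum
      simp at hsum
      rw [fac_of_atom hA0 hs hsum]
      simp
    | insert e J heJ ih =>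
      intro hJ s hs hsum
      have hJ0 : J ⊆ G0 := fun x hx => hJ (Finset.mem_insert_of_mem hx)
      rw [Finset.card_insert_of_notMem heJ]
      refine hc.step (F := A0 + ∑ e ∈ J, vtx e) ?_ (ih hJ0) (hJ (Finset.mem_insert_self e J)) s hs ?_
      · intro g hg
        rcases Multiset.mem_add.1 hg with h1 | h1
        · exact hA0o g h1
        · obtain ⟨x, hx, hgx⟩ := Multiset.mem_sum.1 h1
          rw [mem_vtx.1 hgx]; exact hJ0 hx
      · rw [hsum, Finset.sum_insert heJ]
        abel
  set J := G0.erase h with hJ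
  set F := A0 + ∑ e ∈ J, vtx e with hF
  have hcntJ : ∀ g, (∑ e ∈ J, vtx e).count g = if g ∈ J then addOrderOf g else 0 := by
    intro g
    rw [Multiset.count_sum']
    simp [count_vtx]
  have hWF : W ≤ F := by
    rw [Multiset.le_iff_count]
    intro g
    rw [hF, Multiset.count_add, hcntJ]
    by_cases hgW : g ∈ W
    · by_cases hgh : g = h
      · subst hgh
        have := hWle A0 hA0 hA0o hA0k
        omega
      · have : g ∈ J := by rw [hJ, Finset.mem_erase]; exact ⟨hgh, hW.2.1 g hgW⟩
        rw [if_pos this]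
        have := hW.1.count_le g
        omega
    · rw [Multiset.count_eq_zero_of_notMem hgW]; omega
  have hsumJ : (∑ e ∈ J, vtx e).sum = 0 := by
    have h1 : (∑ e ∈ J, vtx e) = (J.val.map vtx).sum := rfl
    rw [h1]
    apply ZFac.sum_sum
    intro A hA
    obtain ⟨e, he, rfl⟩ := Multiset.mem_map.1 hA
    exact vtx_atom e
  have hkJ : kN n (∑ e ∈ J, vtx e) = n * J.card := by
    have : (∑ e ∈ J, vtx e) = (J.val.map vtx).sum := rfl
    rw [this, kN_fac_eq]
    · simp
    · intro A hA
      obtain ⟨e, he, rfl⟩ := Multiset.mem_map.1 hA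
      exact kN_vtx (hc.hord e (Finset.mem_of_mem_erase he))
  have hFo : ∀ g ∈ F, g ∈ G0 := by
    intro g hg
    rcases Multiset.mem_add.1 hg with h1 | h1
    · exact hA0o g h1
    · obtain ⟨x, hx, hgx⟩ := Multiset.mem_sum.1 h1
      rw [mem_vtx.1 hgx]; exact Finset.mem_of_mem_erase hx
  have hF0 : F.sum = 0 := by rw [hF, Multiset.sum_add, hA0.2.1, hsumJ, add_zero]
  obtain ⟨t, ht, htC⟩ := exists_fac (F - W) (sum_sub_zero hWF hW.1.2.1 hF0)
  have hadd : F - W + W = F := Multiset.sub_add_cancel hWF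
  have hlen := hgrow J (Finset.erase_subset _ _) (W ::ₘ t) (ZFac.cons hW.1 ht)
    (by rw [Multiset.sum_cons, htC, add_comm, hadd])
  rw [Multiset.card_cons] at hlen
  have hto : ∀ A ∈ t, ∀ g ∈ A, g ∈ G0 :=
    over_of_mem htC (fun g hg => hFo g (Multiset.mem_of_le tsub_le_self hg))
  have hexc : ∀ u : Multiset (Multiset G), ZFac u → (∀ A ∈ u, ∀ g ∈ A, g ∈ G0) →
      ((kN n u.sum : ℤ) - n * u.card) * (A0.count h) ≤ ((kN n A0 : ℤ) - n) * (u.sum.count h) := by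
    intro u
    induction u using Multiset.induction_on with
    | empty => intro _ _; simp [kN]
    | cons A u ih =>
      intro hu huo
      have h1 := ih (hu.mono (Multiset.le_cons_self u A)) (fun B hB => huo B (by simp [hB]))
      have h2 := hslope A (hu A (by simp)) (huo A (by simp))
      rw [Multiset.sum_cons, kN_add, Multiset.card_cons, Multiset.count_add]
      push_cast
      nlinarith
  have hfin := hexc t ht hto
  rw [htC] at hfin
  have hk1 := congrArg (kN n) hadd
  rw [kN_add, hW.2.2, hF, kN_add, hkJ, ← hF] at hk1
  have hc1 := congrArg (Multiset.count h) hadd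
  have hhJ : h ∉ J := by simp [hJ]
  rw [Multiset.count_add, hF, Multiset.count_add, hcntJ, if_neg hhJ, add_zero, ← hF] at hc1
  have hlen' : n * t.card ≤ n * J.card := Nat.mul_le_mul_left _ (by omega)
  have he0 : (0 : ℤ) < (kN n A0 : ℤ) - n := by
    have := hc.lcn A0 hA0 hA0o
    omega
  have h1 : ((kN n A0 : ℤ) - n) ≤ (kN n (F - W) : ℤ) - n * t.card := by
    have : (n * t.card : ℤ) ≤ n * J.card := by exact_mod_cast hlen'
    have : (kN n (F - W) : ℤ) + n = kN n A0 + n * J.card := by exact_mod_cast hk1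
    linarith
  have h2 : ((F - W).count h : ℤ) < A0.count h := by omega
  have hv0' : (0 : ℤ) < A0.count h := by exact_mod_cast hv0
  have h3 := mul_le_mul_of_nonneg_right h1 hv0'.le
  have h4 := mul_lt_mul_of_pos_left h2 he0
  linarith

/-- Main lemma: an LCN-set `G0` whose lengths are all congruent modulo `d`, with `d` large
compared with the rank and the exponent, has only atoms of cross number one. -/
theorem main_lcn {n d r : ℕ} (hn : 0 < n) (hd : 1 ≤ d) (hnd : n ≤ d + 3) (hrd : r ≤ d)
    (hp : ∀ p : ℕ, p.Prime → Nat.card {x : G // p • x = 0} ≤ p ^ r) (G0 : Finset G) :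
    (∀ g ∈ G0, addOrderOf g ∣ n) → HD (G0 : Set G) d →
    (∀ A, ZAtom A → (∀ g ∈ A, g ∈ G0) → n ≤ kN n A) →
    ∀ A, ZAtom A → (∀ g ∈ A, g ∈ G0) → kN n A = n := by
  induction G0 using Finset.strongInduction with
  | H G0 ih =>
  intro hord hHD lcn
  have hgood : ∀ A, ZAtom A → (∀ g ∈ A, g ∈ G0) → ∀ g ∈ G0, g ∉ A → kN n A = n := by
    intro A hA hA0 g hg hgA
    have hsub : G0.erase g ⊂ G0 := Finset.erase_ssubset hg
    refine ih _ hsub (fun x hx => hord x (hsub.1 hx)) (hHD.mono (by exact_mod_cast hsub.1))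
      (fun B hB hB0 => lcn B hB (fun x hx => hsub.1 (hB0 x hx))) A hA ?_
    intro x hx
    rw [Finset.mem_erase]
    exact ⟨fun h => hgA (h ▸ hx), hA0 x hx⟩
  have hc : Core G0 n d := ⟨hn, hord, hd, hnd, hHD, lcn, hgood⟩
  by_contra hcon
  push Not at hcon
  obtain ⟨A, hA, hA0, hAk⟩ := hcon
  have hfull : ∀ B, ZAtom B → (∀ g ∈ B, g ∈ G0) → kN n B ≠ n → ∀ g ∈ G0, g ∈ B := by
    intro B hB hB0 hBk g hg
    by_contra hgB
    exact hBk (hgood B hB hB0 g hg hgB)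
  have hAlt : kN n A > n := lt_of_le_of_ne (lcn A hA hA0) (Ne.symm hAk)
  -- the product of all vertices
  set V : Multiset (Multiset G) := G0.val.map vtx with hV
  have hVf : ZFac V := by
    intro B hB
    obtain ⟨e, he, rfl⟩ := Multiset.mem_map.1 hB
    exact vtx_atom e
  have hVk : kN n V.sum = n * G0.card := by
    rw [kN_fac_eq]
    · simp [hV]
    · intro B hB
      obtain ⟨e, he, rfl⟩ := Multiset.mem_map.1 hB
      exact kN_vtx (hord e he)
  have hVo : ∀ g ∈ V.sum, g ∈ G0 := by
    apply over_msum
    intro B hB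
    obtain ⟨e, he, rfl⟩ := Multiset.mem_map.1 hB
    intro g hg
    rw [mem_vtx.1 hg]; exact he
  have hAV : A ≤ V.sum := by
    rw [Multiset.le_iff_count]
    intro g
    by_cases hg : g ∈ A
    · have h1 : vtx g ≤ V.sum := le_of_mem_fac (Multiset.mem_map_of_mem vtx (hA0 g hg))
      have h2 := Multiset.count_le_of_le g h1
      rw [count_vtx, if_pos rfl] at h2
      exact (hA.count_le g).trans h2
    · rw [Multiset.count_eq_zero_of_notMem hg]; omega
  obtain ⟨t, ht, htA⟩ := exists_fac (V.sum - A) (sum_sub_zero hAV hA.2.1 hVf.sum_sum)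
  have hadd : V.sum - A + A = V.sum := Multiset.sub_add_cancel hAV
  have hk1 := congrArg (kN n) hadd
  rw [kN_add, hVk, ← htA] at hk1
  have hk2 := kN_fac_ge (n := n) (s := t) (fun B hB => lcn B (ht B hB)
    (over_of_mem htA (fun g hg => hVo g (Multiset.mem_of_le tsub_le_self hg)) B hB))
  have hts : t.card + 1 < G0.card := by
    have : n * (t.card + 1) < n * G0.card := by nlinarith
    exact Nat.lt_of_mul_lt_mul_left this
  have htpos : 0 < t.card := by
    rw [Multiset.card_pos]
    rintro rfl
    rw [← htA] at hadd
    simp at hadd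
    have h1 := fac_of_atom hA hVf hadd.symm
    have h2 := congrArg Multiset.card h1
    simp [hV] at h2
    simp at hts
    omega
  have hlen := hHD V (A ::ₘ t) hVf (ZFac.cons hA ht)
    (by rw [Multiset.sum_cons, htA, add_comm, hadd]) hVo
  have hds : d + 2 ≤ G0.card := by
    simp only [hV, Multiset.card_map, Multiset.card_cons] at hlen
    have h2 := (Nat.modEq_iff_dvd' (by simp; omega)).1 hlen.symm
    have h3 := Nat.le_of_dvd (by simp; omega) h2
    simp at h3
    omega
  obtain ⟨h, hh⟩ : G0.Nonempty := Finset.card_pos.1 (by omega)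
  have hpig : PigeonHyp G0 h := by
    intro p hpp
    exact pigeon_prime (G0.erase h) p r hpp (hp p hpp) (by
      rw [Finset.card_erase_of_mem hh]; omega)
  have hcA : ∀ B, ZAtom B → (∀ g ∈ B, g ∈ G0) → kN n B ≠ n →
      addOrderOf (h : G ⧸ AddSubgroup.closure ((G0.erase h : Finset G) : Set G)) ≤ B.count h := by
    intro B hB hB0 hBk
    exact Nat.le_of_dvd (Multiset.count_pos.2 (hfull B hB hB0 hBk h hh))
      (Core.dvd_count hB.2.1 hB0)
  have hlt : addOrderOf (h : G ⧸ AddSubgroup.closure ((G0.erase h : Finset G) : Set G)) <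
      addOrderOf h := by
    refine lt_of_le_of_lt (hcA A hA hA0 hAk) ?_
    by_contra hge
    have := hA.eq_vtx (g := h) (by omega)
    exact hAk (this ▸ kN_vtx (hord h hh))
  obtain ⟨W, hW, hWc⟩ := hc.exists_unit_atom hh hpig hlt
  exact hAk (hc.no_bad hh hW (by rw [hWc]; exact addOrderOf_pos _)
    (fun B hB hB0 hBk => by rw [hWc]; exact hcA B hB hB0 hBk) A hA hA0)

end MainLCN

section FamPart

/-- Long sets of lengths in a single residue class mod `d`, containing `u`, `v` with
`a * u ≤ b * v` and `u` large. -/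
def Fam (G : Type*) [AddCommGroup G] (d a b : ℕ) : Prop :=
  ∀ K : ℕ, ∃ L ∈ systemL (Set.univ : Set G), (∀ x ∈ L, ∀ y ∈ L, x ≡ y [MOD d]) ∧
    ∃ u ∈ L, ∃ v ∈ L, K ≤ u ∧ a * u ≤ b * v

theorem Fam.transfer {G G' : Type*} [AddCommGroup G] [AddCommGroup G']
    (hL : systemL (Set.univ : Set G) = systemL (Set.univ : Set G')) {d a b : ℕ}
    (h : Fam G d a b) : Fam G' d a b := by
  intro K
  have := h K
  rwa [hL] at this

variable {G : Type*} [AddCommGroup G]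

theorem fam_of_HD {G0 : Set G} {d a b : ℕ} (hHD : HD G0 d) {s t : Multiset (Multiset G)}
    (hs : ZFac s) (ht : ZFac t) (hst : s.sum = t.sum) (h0 : ∀ g ∈ s.sum, g ∈ G0)
    (hpos : 0 < s.card) (hab : a * s.card ≤ b * t.card) : Fam G d a b := by
  intro K
  refine ⟨lengthSet Set.univ (K • s.sum), ⟨K • s.sum, ⟨by simp, ?_⟩, rfl⟩, ?_, ?_⟩
  · rw [Multiset.sum_nsmul, hs.sum_sum, smul_zero]
  · intro x hx y hy
    obtain ⟨s1, hs1, hs1s, rfl⟩ := (mem_lengthSet_iff _ _).1 hx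
    obtain ⟨t1, ht1, ht1s, rfl⟩ := (mem_lengthSet_iff _ _).1 hy
    refine hHD s1 t1 hs1 ht1 (by rw [hs1s, ht1s]) ?_
    intro g hg
    rw [hs1s] at hg
    exact h0 g (Multiset.mem_of_mem_nsmul hg)
  · refine ⟨K * s.card, (mem_lengthSet_iff _ _).2 ⟨K • s, hs.nsmul K, by rw [Multiset.sum_nsmul], by simp⟩,
      K * t.card, (mem_lengthSet_iff _ _).2 ⟨K • t, ht.nsmul K, by rw [Multiset.sum_nsmul, hst], by simp⟩,
      Nat.le_mul_of_pos_right _ hpos, ?_⟩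
    nlinarith

theorem HD_of_weight {G0 : Set G} {d M : ℕ} (hM : 0 < M) (w : G → ℕ)
    (hw : ∀ A, ZAtom A → (∀ g ∈ A, g ∈ G0) → (A.map w).sum ≡ M [MOD (M * d)]) : HD G0 d := by
  have key : ∀ s : Multiset (Multiset G), ZFac s → (∀ g ∈ s.sum, g ∈ G0) →
      (s.sum.map w).sum ≡ M * s.card [MOD (M * d)] := by
    intro s
    induction s using Multiset.induction_on with
    | empty => intro _ _; simp; rfl
    | cons A s ih =>
      intro hs h0
      have h1 := ih (hs.mono (Multiset.le_cons_self s A))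
        (fun g hg => h0 g (by rw [Multiset.sum_cons]; exact Multiset.mem_add.2 (Or.inr hg)))
      have h2 := hw A (hs A (by simp))
        (fun g hg => h0 g (by rw [Multiset.sum_cons]; exact Multiset.mem_add.2 (Or.inl hg)))
      rw [Multiset.sum_cons, Multiset.map_add, Multiset.sum_add, Multiset.card_cons, mul_add,
        mul_one, add_comm]
      exact h1.add h2
  intro s t hs ht hst h0
  have h1 := key s hs h0
  have h2 := key t ht (hst ▸ h0)
  rw [← hst] at h2
  exact Nat.ModEq.mul_left_cancel' hM.ne' (h1.symm.trans h2)

theorem mono_unbounded (c : ℕ → ℕ) (h : ∀ i, ∃ j, c i < c j) : ∀ N, ∃ i, N ≤ c i := by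
  intro N
  induction N with
  | zero => exact ⟨0, Nat.zero_le _⟩
  | succ N ih =>
    obtain ⟨i, hi⟩ := ih
    obtain ⟨j, hj⟩ := h i
    exact ⟨j, by omega⟩

theorem fam_extract [Finite G] {d a b : ℕ} (hF : Fam G d a b) :
    ∃ G0 : Finset G, HD (G0 : Set G) d ∧ ∃ s t : Multiset (Multiset G), ZFac s ∧ ZFac t ∧
      s.sum = t.sum ∧ (∀ g ∈ s.sum, g ∈ G0) ∧ 0 < s.card ∧ a * s.card ≤ b * t.card := by
  have := Fintype.ofFinite G
  have hdata : ∀ K : ℕ, ∃ s t : Multiset (Multiset G), ZFac s ∧ ZFac t ∧ s.sum = t.sum ∧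
      K ≤ s.card ∧ a * s.card ≤ b * t.card ∧
      ∀ u w : Multiset (Multiset G), ZFac u → ZFac w → u.sum = s.sum → w.sum = s.sum →
        u.card ≡ w.card [MOD d] := by
    intro K
    obtain ⟨L, ⟨B, -, rfl⟩, hcong, u, hu, v, hv, hKu, huv⟩ := hF K
    obtain ⟨s, hs, hsB, rfl⟩ := (mem_lengthSet_iff _ _).1 hu
    obtain ⟨t, ht, htB, rfl⟩ := (mem_lengthSet_iff _ _).1 hv
    refine ⟨s, t, hs, ht, by rw [hsB, htB], hKu, huv, ?_⟩
    intro u w hu hw hus hws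
    exact hcong _ ((mem_lengthSet_iff _ _).2 ⟨u, hu, by rw [hus, hsB], rfl⟩)
      _ ((mem_lengthSet_iff _ _).2 ⟨w, hw, by rw [hws, hsB], rfl⟩)
  choose s t hs ht hst hK hab hcong using hdata
  have hfinA : Finite {A : Multiset G // ZAtom A} := atoms_finite.to_subtype
  let vec : ℕ → ({A : Multiset G // ZAtom A} → ℕ) × ({A : Multiset G // ZAtom A} → ℕ) × ℕ :=
    fun K => (fun A => (s K).count A.1, fun A => (t K).count A.1, b * (t K).card - a * (s K).card)
  obtain ⟨φ, hφ⟩ := (Set.isPWO_of_wellQuasiOrderedLE (Set.univ)).exists_monotone_subseq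
    (f := vec) (fun _ => Set.mem_univ _)
  have hle_of : ∀ u w : Multiset (Multiset G), ZFac u →
      (∀ A : {A : Multiset G // ZAtom A}, u.count A.1 ≤ w.count A.1) → u ≤ w := by
    intro u w hu h
    rw [Multiset.le_iff_count]
    intro A
    by_cases hA : A ∈ u
    · exact h ⟨A, hu A hA⟩
    · rw [Multiset.count_eq_zero_of_notMem hA]; omega
  have hSm : Monotone (fun i => s (φ i)) := fun i j hij =>
    hle_of _ _ (hs _) (fun A => (hφ hij).1 A)
  have hTm : Monotone (fun i => t (φ i)) := fun i j hij =>
    hle_of _ _ (ht _) (fun A => (hφ hij).2.1 A)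
  have hδ : ∀ i j, i ≤ j → b * (t (φ i)).card - a * (s (φ i)).card ≤
      b * (t (φ j)).card - a * (s (φ j)).card := fun i j hij => (hφ hij).2.2
  set c : G → ℕ → ℕ := fun g i => (s (φ i)).sum.count g with hc
  have hBm : Monotone (fun i => (s (φ i)).sum) := by
    intro i j hij
    have h1 : s (φ i) ≤ s (φ j) := hSm hij
    have : (s (φ j)).sum = (s (φ j) - s (φ i)).sum + (s (φ i)).sum := by
      rw [← Multiset.sum_add, Multiset.sub_add_cancel h1]
    show (s (φ i)).sum ≤ (s (φ j)).sum
    rw [this]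
    exact le_add_self
  have hcm : ∀ g, Monotone (c g) := fun g i j hij => Multiset.count_le_of_le g (hBm hij)
  let G0 : Finset G := Finset.univ.filter (fun g => ∀ i, ∃ j, c g i < c g j)
  have hG0 : ∀ g, g ∈ G0 ↔ ∀ i, ∃ j, c g i < c g j := fun g => by simp [G0]
  refine ⟨G0, ?_, ?_⟩
  · intro u w hu hw huw h0
    have h1 : ∀ g, ∃ j, u.sum.count g ≤ c g j := by
      intro g
      by_cases hg : g ∈ u.sum
      · exact mono_unbounded _ ((hG0 g).1 (h0 g hg)) _
      · exact ⟨0, by rw [Multiset.count_eq_zero_of_notMem hg]; omega⟩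
    choose j hj using h1
    obtain ⟨M, hM⟩ := Finite.exists_le j
    have hle : u.sum ≤ (s (φ M)).sum := by
      rw [Multiset.le_iff_count]
      intro g
      exact (hj g).trans (hcm g (hM g))
    obtain ⟨z, hz, hzs⟩ := exists_fac _ (sum_sub_zero hle hu.sum_sum (hs (φ M)).sum_sum)
    have h2 := hcong (φ M) (u + z) (w + z) (hu.add hz) (hw.add hz)
      (by rw [Multiset.sum_add, hzs, add_comm, Multiset.sub_add_cancel hle])
      (by rw [Multiset.sum_add, hzs, ← huw, add_comm, Multiset.sub_add_cancel hle])
    rw [Multiset.card_add, Multiset.card_add] at h2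
    exact Nat.ModEq.add_right_cancel' _ h2
  · have h1 : ∀ g, ∃ i, g ∉ G0 → ∀ j, c g j ≤ c g i := by
      intro g
      by_cases hg : g ∈ G0
      · exact ⟨0, fun h => absurd hg h⟩
      · have := (not_congr (hG0 g)).1 hg
        push Not at this
        obtain ⟨i, hi⟩ := this
        exact ⟨i, fun _ => hi⟩
    choose ig hig using h1
    obtain ⟨I, hI⟩ := Finite.exists_le ig
    set j := max I ((s (φ I)).card + 1) with hjdef
    have hIj : I ≤ j := le_max_left _ _
    have hSle : s (φ I) ≤ s (φ j) := hSm hIj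
    have hTle : t (φ I) ≤ t (φ j) := hTm hIj
    have hSadd : (s (φ j) - s (φ I)).sum + (s (φ I)).sum = (s (φ j)).sum := by
      rw [← Multiset.sum_add, Multiset.sub_add_cancel hSle]
    have hTadd : (t (φ j) - t (φ I)).sum + (t (φ I)).sum = (t (φ j)).sum := by
      rw [← Multiset.sum_add, Multiset.sub_add_cancel hTle]
    have hjφ : j ≤ φ j := φ.strictMono.le_apply
    have hcardj := hK (φ j)
    have hjge : (s (φ I)).card + 1 ≤ j := le_max_right _ _
    refine ⟨s (φ j) - s (φ I), t (φ j) - t (φ I), (hs _).mono tsub_le_self, (ht _).mono tsub_le_self,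
      ?_, ?_, ?_, ?_⟩
    · rw [← hst, ← hst, ← hSadd] at hTadd
      exact (add_right_cancel hTadd).symm
    · intro g hg
      by_contra hgG
      have h2 := congrArg (Multiset.count g) hSadd
      rw [Multiset.count_add] at h2
      have h3 : 0 < (s (φ j) - s (φ I)).sum.count g := Multiset.count_pos.2 hg
      have h4 : c g j ≤ c g (ig g) := hig g hgG j
      have h5 : c g (ig g) ≤ c g I := hcm g (hI g)
      simp only [hc] at h4 h5
      omega
    · rw [Multiset.card_sub hSle]; omega
    · rw [Multiset.card_sub hSle, Multiset.card_sub hTle]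
      have h2 := hδ I j hIj
      have h3 := hab (φ I)
      have h4 := hab (φ j)
      have h5 : a * (s (φ I)).card ≤ a * (s (φ j)).card :=
        Nat.mul_le_mul_left _ (Multiset.card_le_card hSle)
      have h6 : b * (t (φ I)).card ≤ b * (t (φ j)).card :=
        Nat.mul_le_mul_left _ (Multiset.card_le_card hTle)
      rw [Nat.mul_sub, Nat.mul_sub]
      omega

end FamPart

section IndepPart

variable {G : Type*} [AddCommGroup G] {ι : Type*} [Fintype ι]

/-- `e` is an independent family with orders `o i ≥ 2`. -/
structure Indep (e : ι → G) (o : ι → ℕ) : Prop where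
  two_le : ∀ i, 2 ≤ o i
  ord : ∀ i, o i • e i = 0
  ind : ∀ c : ι → ℤ, ∑ i, c i • e i = 0 → ∀ i, (o i : ℤ) ∣ c i

theorem Indep.inj {e : ι → G} {o : ι → ℕ} (h : Indep e o) : Function.Injective e := by
  intro i j hij
  by_contra hne
  have h1 := h.ind (Pi.single i 1 - Pi.single j 1) (by
    simp [sub_smul, Pi.single_apply, ite_smul, hij]) i
  simp [hne] at h1
  have := h.two_le i
  have h2 : (o i : ℤ) ∣ ((1 : ℕ) : ℤ) := by simpa using h1
  have := Nat.le_of_dvd one_pos (Int.natCast_dvd_natCast.1 h2)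
  omega

theorem Indep.sum_ne [Nontrivial ι] {e : ι → G} {o : ι → ℕ} (h : Indep e o) (i : ι) :
    e i ≠ ∑ j, e j := by
  intro hij
  obtain ⟨j, hj⟩ := exists_ne i
  have h1 := h.ind (1 - Pi.single i 1) (by
    simp [sub_smul, Pi.single_apply, ite_smul, ← hij]) j
  simp [hj] at h1
  have := h.two_le j
  have h2 : (o j : ℤ) ∣ ((1 : ℕ) : ℤ) := by simpa using h1
  have := Nat.le_of_dvd one_pos (Int.natCast_dvd_natCast.1 h2)
  omega

theorem Indep.ind_nat {e : ι → G} {o : ι → ℕ} (h : Indep e o) (c : ι → ℕ)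
    (hc : ∑ i, c i • e i = 0) (i : ι) : o i ∣ c i := by
  have := h.ind (fun i => (c i : ℤ)) (by simpa using hc) i
  exact Int.natCast_dvd_natCast.1 this

theorem Indep.addOrderOf_eq {e : ι → G} {o : ι → ℕ} (h : Indep e o) (i : ι) :
    addOrderOf (e i) = o i := by
  apply Nat.dvd_antisymm
  · exact addOrderOf_dvd_of_nsmul_eq_zero (h.ord i)
  · have := h.ind_nat (Pi.single i (addOrderOf (e i))) (by
      rw [Finset.sum_eq_single i]
      · simp [addOrderOf_nsmul_eq_zero]
      · intro j _ hj; simp [hj]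
      · simp) i
    simpa using this

/-- The decomposition of a multiset over `{e0} ∪ range e`. -/
theorem decomp_family {e : ι → G} (hinj : Function.Injective e) {e0 : G} (h0 : ∀ i, e i ≠ e0)
    (T : Multiset G) (hT : ∀ g ∈ T, g = e0 ∨ ∃ i, g = e i) :
    T = Multiset.replicate (T.count e0) e0 + ∑ i, Multiset.replicate (T.count (e i)) (e i) := by
  ext g
  rw [Multiset.count_add, Multiset.count_sum']
  simp only [Multiset.count_replicate]
  by_cases hg0 : g = e0
  · subst hg0
    simp [h0]
  · by_cases hgi : ∃ i, g = e i
    · obtain ⟨i, rfl⟩ := hgi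
      simp [Ne.symm hg0, hinj.eq_iff]
    · have h1 : g ∉ T := fun hg => (hT g hg).elim hg0 hgi
      push Not at hgi
      rw [Multiset.count_eq_zero_of_notMem h1]
      simp [Ne.symm hg0, fun i => Ne.symm (hgi i)]

theorem decomp_sum {e : ι → G} (hinj : Function.Injective e) {e0 : G} (h0 : ∀ i, e i ≠ e0)
    (T : Multiset G) (hT : ∀ g ∈ T, g = e0 ∨ ∃ i, g = e i) :
    T.sum = T.count e0 • e0 + ∑ i, T.count (e i) • e i := by
  conv_lhs => rw [decomp_family hinj h0 T hT]
  rw [Multiset.sum_add, Multiset.sum_replicate]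
  congr 1
  have : ∀ s : Finset ι, (∑ i ∈ s, Multiset.replicate (T.count (e i)) (e i)).sum =
      ∑ i ∈ s, T.count (e i) • e i := by
    intro s
    induction s using Finset.induction_on with
    | empty => simp
    | insert i s hi ih => rw [Finset.sum_insert hi, Finset.sum_insert hi, Multiset.sum_add, ih,
        Multiset.sum_replicate]
  exact this _

theorem decomp_weight {e : ι → G} (hinj : Function.Injective e) {e0 : G} (h0 : ∀ i, e i ≠ e0)
    (T : Multiset G) (hT : ∀ g ∈ T, g = e0 ∨ ∃ i, g = e i) (w : G → ℕ) :
    (T.map w).sum = T.count e0 * w e0 + ∑ i, T.count (e i) * w (e i) := by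
  conv_lhs => rw [decomp_family hinj h0 T hT]
  rw [Multiset.map_add, Multiset.sum_add, Multiset.map_replicate, Multiset.sum_replicate,
    smul_eq_mul]
  congr 1
  have : ∀ s : Finset ι, ((∑ i ∈ s, Multiset.replicate (T.count (e i)) (e i)).map w).sum =
      ∑ i ∈ s, T.count (e i) * w (e i) := by
    intro s
    induction s using Finset.induction_on with
    | empty => simp
    | insert i s hi ih => rw [Finset.sum_insert hi, Finset.sum_insert hi, Multiset.map_add,
        Multiset.sum_add, ih, Multiset.map_replicate, Multiset.sum_replicate, smul_eq_mul]
  exact this _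

/-- Zero-sum multisets over `{e0} ∪ range e` with `e0 = ∑ e i`. -/
theorem Indep.zero_sum [Nontrivial ι] {e : ι → G} {o : ι → ℕ} (h : Indep e o) (T : Multiset G)
    (hT : ∀ g ∈ T, g = (∑ j, e j) ∨ ∃ i, g = e i) (hT0 : T.sum = 0) (i : ι) :
    o i ∣ T.count (∑ j, e j) + T.count (e i) := by
  rw [decomp_sum h.inj h.sum_ne T hT, Finset.smul_sum, ← Finset.sum_add_distrib] at hT0
  exact h.ind_nat (fun i => T.count (∑ j, e j) + T.count (e i)) (by
    rw [← hT0]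
    apply Finset.sum_congr rfl
    intro i _
    rw [add_smul]) i

/-- The atom `e0 ∏ e i ^ (o i - 1)`. -/
noncomputable def bigAtom (e : ι → G) (o : ι → ℕ) : Multiset G :=
  {∑ j, e j} + ∑ i, Multiset.replicate (o i - 1) (e i)

theorem mem_bigAtom {e : ι → G} {o : ι → ℕ} {g : G} (hg : g ∈ bigAtom e o) :
    g = (∑ j, e j) ∨ ∃ i, g = e i := by
  rw [bigAtom, Multiset.mem_add] at hg
  rcases hg with hg | hg
  · left; exact Multiset.mem_singleton.1 hg
  · right
    obtain ⟨i, -, hi⟩ := Multiset.mem_sum.1 hg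
    exact ⟨i, Multiset.eq_of_mem_replicate hi⟩

theorem Indep.count_bigAtom [Nontrivial ι] {e : ι → G} {o : ι → ℕ} (h : Indep e o) (i : ι) :
    (bigAtom e o).count (e i) = o i - 1 := by
  rw [bigAtom, Multiset.count_add, Multiset.count_sum', Multiset.count_singleton,
    if_neg (h.sum_ne i)]
  simp [Multiset.count_replicate, h.inj.eq_iff]

theorem Indep.count_bigAtom0 [Nontrivial ι] {e : ι → G} {o : ι → ℕ} (h : Indep e o) :
    (bigAtom e o).count (∑ j, e j) = 1 := by
  rw [bigAtom, Multiset.count_add, Multiset.count_sum', Multiset.count_singleton,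
    if_pos rfl]
  simp [Multiset.count_replicate, h.sum_ne]

theorem Indep.bigAtom_atom [Nontrivial ι] {e : ι → G} {o : ι → ℕ} (h : Indep e o) :
    ZAtom (bigAtom e o) := by
  refine ⟨?_, ?_, ?_⟩
  · intro h0
    have := h.count_bigAtom0
    rw [h0] at this
    simp at this
  · rw [decomp_sum h.inj h.sum_ne _ (fun g hg => mem_bigAtom hg), h.count_bigAtom0, one_smul,
      ← Finset.sum_add_distrib]
    apply Finset.sum_eq_zero
    intro i _
    rw [h.count_bigAtom]
    have h1 := h.two_le i
    have : e i + (o i - 1) • e i = o i • e i := by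
      obtain ⟨q, hq⟩ : ∃ q, o i = q + 1 := ⟨o i - 1, by omega⟩
      rw [hq, succ_nsmul]; simp [add_comm]
    rw [this, h.ord]
  · intro T hT hT0
    have hTm : ∀ g ∈ T, g = (∑ j, e j) ∨ ∃ i, g = e i :=
      fun g hg => mem_bigAtom (Multiset.mem_of_le hT hg)
    have hz := h.zero_sum T hTm hT0
    have hc0 := Multiset.count_le_of_le (∑ j, e j) hT
    rw [h.count_bigAtom0] at hc0
    have hci : ∀ i, T.count (e i) ≤ o i - 1 := fun i => by
      have := Multiset.count_le_of_le (e i) hT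
      rwa [h.count_bigAtom] at this
    rcases Nat.eq_zero_or_pos (T.count (∑ j, e j)) with h1 | h1
    · left
      rw [Multiset.eq_zero_iff_forall_notMem]
      intro g hg
      rcases hTm g hg with rfl | ⟨i, rfl⟩
      · exact (Multiset.count_pos.2 hg).ne' h1
      · have h2 := hz i
        rw [h1, zero_add] at h2
        have h3 := Nat.le_of_dvd (Multiset.count_pos.2 hg) h2
        have := hci i
        have := h.two_le i
        omega
    · right
      apply le_antisymm hT
      rw [Multiset.le_iff_count]
      intro g
      by_cases hg : g ∈ bigAtom e o
      · rcases mem_bigAtom hg with rfl | ⟨i, rfl⟩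
        · rw [h.count_bigAtom0]; omega
        · rw [h.count_bigAtom]
          have h3 := Nat.le_of_dvd (by omega) (hz i)
          omega
      · rw [Multiset.count_eq_zero_of_notMem hg]; omega

theorem fam_indep [Finite G] [Nontrivial ι] {e : ι → G} {m : ℕ} (h : Indep e (fun _ => m)) :
    Fam G (Fintype.card ι - 1) (Fintype.card ι + 1) 2 := by
  obtain ⟨i0, i1, hi01⟩ := exists_pair_ne ι
  have hm : 2 ≤ m := h.two_le i0
  have hs2 : 2 ≤ Fintype.card ι := Fintype.one_lt_card
  set e0 := ∑ j, e j with he0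
  have hord0 : addOrderOf e0 = m := by
    apply Nat.dvd_antisymm
    · apply addOrderOf_dvd_of_nsmul_eq_zero
      rw [he0, Finset.smul_sum]
      exact Finset.sum_eq_zero (fun i _ => h.ord i)
    · refine h.ind_nat (fun _ => addOrderOf e0) ?_ i0
      rw [← Finset.smul_sum, addOrderOf_nsmul_eq_zero]
  have hne : ∀ i, e i ≠ e0 := h.sum_ne
  have hHD : HD {g | g = e0 ∨ ∃ i, g = e i} (Fintype.card ι - 1) := by
    refine HD_of_weight (M := m) (by omega) (fun g => if g = e0 then Fintype.card ι else 1) ?_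
    intro A hA hA0
    have hbig : Fintype.card ι * m ≡ m [MOD (m * (Fintype.card ι - 1))] := by
      have : Fintype.card ι * m = m + m * (Fintype.card ι - 1) := by
        obtain ⟨q, hq⟩ : ∃ q, Fintype.card ι = q + 1 := ⟨Fintype.card ι - 1, by omega⟩
        rw [hq]; simp; ring
      rw [this]; simp [Nat.ModEq]
    by_cases hbig0 : m ≤ A.count e0
    · have h1 := hA.eq_vtx (g := e0) (by rw [hord0]; exact hbig0)
      rw [h1, vtx, hord0]
      simpa [mul_comm] using hbig
    by_cases hbigi : ∃ i, m ≤ A.count (e i)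
    · obtain ⟨i, hi⟩ := hbigi
      have h1 := hA.eq_vtx (g := e i) (by rw [h.addOrderOf_eq]; exact hi)
      rw [h1, vtx, h.addOrderOf_eq]
      simp [hne i]
      rfl
    push Not at hbigi hbig0
    have hz := h.zero_sum A hA0 hA.2.1
    rw [← he0] at hz
    have hpos : 0 < A.count e0 := by
      by_contra hcon
      have h1 : A.count e0 = 0 := by omega
      apply hA.1
      rw [Multiset.eq_zero_iff_forall_notMem]
      intro g hg
      have hgp := Multiset.count_pos.2 hg
      rcases hA0 g hg with rfl | ⟨i, rfl⟩
      · omega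
      · have h2 := hz i
        rw [h1, zero_add] at h2
        have := Nat.le_of_dvd hgp h2
        have := hbigi i
        omega
    have hci : ∀ i, A.count (e i) = m - A.count e0 := by
      intro i
      obtain ⟨q, hq⟩ := hz i
      have := hbigi i
      have hq1 : q = 1 := by
        have h1 : 0 < q := by
          rcases Nat.eq_zero_or_pos q with h | h
          · subst h; omega
          · exact h
        have h2 : q < 2 := by
          by_contra hge
          have : m * 2 ≤ m * q := Nat.mul_le_mul_left _ (by omega)
          omega
        omega
      subst hq1; omega
    rw [decomp_weight h.inj hne A hA0]
    simp only [if_true, hne, if_false, mul_one, hci, Finset.sum_const, Finset.card_univ,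
      smul_eq_mul]
    have : A.count e0 * Fintype.card ι + Fintype.card ι * (m - A.count e0) = Fintype.card ι * m := by
      rw [mul_comm (A.count e0), ← mul_add]
      congr 1
      omega
    rw [this]; exact hbig
  let t : Multiset (Multiset G) := vtx e0 ::ₘ ((m - 1) • (Finset.univ.val.map (fun i => vtx (e i))))
  have htf : ZFac t := by
    refine ZFac.cons (vtx_atom _) (ZFac.nsmul ?_ _)
    intro A hA
    obtain ⟨i, -, rfl⟩ := Multiset.mem_map.1 hA
    exact vtx_atom _
  have hsum : (Multiset.replicate m (bigAtom e (fun _ => m))).sum = t.sum := by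
    rw [Multiset.sum_replicate, bigAtom, nsmul_add, Multiset.nsmul_singleton, Multiset.sum_cons,
      Multiset.sum_nsmul]
    congr 1
    · rw [vtx, hord0]
    · change m • (∑ i, Multiset.replicate (m - 1) (e i)) = (m - 1) • (∑ i, vtx (e i))
      rw [Finset.smul_sum, Finset.smul_sum]
      apply Finset.sum_congr rfl
      intro i _
      rw [vtx, h.addOrderOf_eq, Multiset.nsmul_replicate, Multiset.nsmul_replicate, mul_comm]
  refine fam_of_HD hHD (ZFac.replicate h.bigAtom_atom m) htf hsum ?_ ?_ ?_
  · rw [Multiset.sum_replicate]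
    intro g hg
    exact mem_bigAtom (Multiset.mem_of_mem_nsmul hg)
  · simp; omega
  · simp only [Multiset.card_replicate, t, Multiset.card_cons, Multiset.card_nsmul,
      Multiset.card_map, Finset.card_val, Finset.card_univ]
    obtain ⟨q, hq⟩ : ∃ q, m = q + 2 := ⟨m - 2, by omega⟩
    obtain ⟨k, hk⟩ : ∃ k, Fintype.card ι = k + 2 := ⟨Fintype.card ι - 2, by omega⟩
    rw [hq, hk]
    simp only [Nat.add_sub_cancel, show q + 2 - 1 = q + 1 by omega]
    nlinarith [Nat.zero_le (q * k)]

/-- `{x, -x}` is an atom for `x ≠ 0`. -/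
theorem pair_atom {x : G} (hx : x ≠ 0) : ZAtom ({x, -x} : Multiset G) := by
  refine ⟨by simp, by simp, ?_⟩
  intro T hT hT0
  have hc := Multiset.card_le_card hT
  simp at hc
  rcases Nat.lt_or_ge T.card 2 with h | h
  · left
    interval_cases hTc : T.card
    · exact Multiset.card_eq_zero.1 hTc
    · obtain ⟨a, rfl⟩ := Multiset.card_eq_one.1 hTc
      simp at hT0
      subst hT0
      have : (0 : G) ∈ ({x, -x} : Multiset G) := Multiset.mem_of_le hT (by simp)
      simp at this
      rcases this with h | h
      · exact absurd h.symm hx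
      · exact absurd h hx
  · right
    exact Multiset.eq_of_le_of_card_le hT (by simp; omega)

theorem fam_cyclic [Finite G] {g : G} {N : ℕ} (hg : addOrderOf g = N) (hN : 3 ≤ N) :
    Fam G (N - 2) N 2 := by
  have hgn : g ≠ 0 := by rintro rfl; simp at hg; omega
  have hng : -g ≠ g := by
    intro h
    have h2 : 2 • g = 0 := by
      rw [two_nsmul]; nth_rewrite 1 [← h]; simp
    have := Nat.le_of_dvd (by omega) (addOrderOf_dvd_of_nsmul_eq_zero h2)
    omega
  have hord' : addOrderOf (-g) = N := by rw [addOrderOf_neg, hg]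
  have hHD : HD {x | x = g ∨ x = -g} (N - 2) := by
    refine HD_of_weight (M := N) (by omega) (fun x => if x = g then 1 else N - 1) ?_
    intro A hA hA0
    by_cases h1 : g ∈ A
    · by_cases h2 : -g ∈ A
      · have hle : ({g, -g} : Multiset G) ≤ A := by
          rw [Multiset.insert_eq_cons, Multiset.cons_le_of_notMem (by simp [hng.symm])]
          exact ⟨h1, Multiset.singleton_le.2 h2⟩
        rw [← (pair_atom hgn).le_atom hA hle]
        simp [hng]
        rw [show 1 + (N - 1) = N by omega]
      · have hAr : A = Multiset.replicate A.card g :=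
          Multiset.eq_replicate_card.2 (fun b hb => (hA0 b hb).resolve_right (fun h => h2 (h ▸ hb)))
        have h3 := hA.2.1
        rw [hAr, Multiset.sum_replicate] at h3
        have h4 := Nat.le_of_dvd (Multiset.card_pos.2 hA.1) (addOrderOf_dvd_of_nsmul_eq_zero h3)
        have h5 := hA.eq_vtx (g := g) (by rw [hAr, Multiset.count_replicate_self]; exact h4)
        rw [h5, vtx, hg]
        simp
        rfl
    · have hAr : A = Multiset.replicate A.card (-g) :=
        Multiset.eq_replicate_card.2 (fun b hb => (hA0 b hb).resolve_left (fun h => h1 (h ▸ hb)))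
      have h3 := hA.2.1
      rw [hAr, Multiset.sum_replicate] at h3
      have h4 := Nat.le_of_dvd (Multiset.card_pos.2 hA.1) (addOrderOf_dvd_of_nsmul_eq_zero h3)
      have h5 := hA.eq_vtx (g := -g) (by rw [hAr, Multiset.count_replicate_self]; exact h4)
      rw [h5, vtx, hord']
      simp [hng]
      have : N * (N - 1) = N + N * (N - 2) := by
        obtain ⟨q, hq⟩ : ∃ q, N = q + 2 := ⟨N - 2, by omega⟩
        rw [hq]; simp; ring
      rw [this]; simp [Nat.ModEq]
  refine fam_of_HD hHD (s := {vtx g, vtx (-g)}) (t := Multiset.replicate N {g, -g})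
    ?_ (ZFac.replicate (pair_atom hgn) N) ?_ ?_ (by simp) (by simp [mul_comm])
  · intro A hA
    simp at hA
    rcases hA with rfl | rfl <;> exact vtx_atom _
  · rw [Multiset.sum_replicate]
    have : ({g, -g} : Multiset G) = {g} + {-g} := rfl
    rw [this, nsmul_add, Multiset.nsmul_singleton, Multiset.nsmul_singleton]
    simp [vtx, hg]
  · intro x hx
    simp [mem_vtx] at hx
    exact hx

end IndepPart

section CasePart
variable {G : Type*} [AddCommGroup G]

theorem kN_le_of_le {n : ℕ} {A B : Multiset G} (h : A ≤ B) : kN n A ≤ kN n B := by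
  obtain ⟨C, rfl⟩ := Multiset.le_iff_exists_add.1 h
  rw [kN_add]; omega

theorem kN_fac_le {n : ℕ} {s : Multiset (Multiset G)} (h : ∀ A ∈ s, kN n A ≤ n) :
    kN n s.sum ≤ n * s.card := by
  induction s using Multiset.induction_on with
  | empty => simp [kN]
  | cons A s ih =>
    have h1 := h A (by simp)
    have h2 := ih (fun B hB => h B (by simp [hB]))
    rw [Multiset.sum_cons, kN_add, Multiset.card_cons, mul_add]
    omega

theorem kN_fac_ge' {n c : ℕ} {s : Multiset (Multiset G)} (h : ∀ A ∈ s, c ≤ kN n A) :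
    c * s.card ≤ kN n s.sum := by
  induction s using Multiset.induction_on with
  | empty => simp
  | cons A s ih =>
    have h1 := h A (by simp)
    have h2 := ih (fun B hB => h B (by simp [hB]))
    rw [Multiset.sum_cons, kN_add, Multiset.card_cons, mul_add]
    omega

theorem kN_one_lt [Finite G] {n : ℕ} (hn0 : 0 < n) (hn : ∀ g : G, addOrderOf g ∣ n)
    {A : Multiset G} (hA : ZAtom A) (hlt : kN n A < n) : 2 ≤ A.card := by
  by_contra h
  have hc : A.card ≠ 0 := fun h0 => hA.1 (Multiset.card_eq_zero.1 h0)
  have h1 : A.card = 1 := by omega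
  obtain ⟨a, rfl⟩ := Multiset.card_eq_one.1 h1
  have ha : a = 0 := by simpa using hA.2.1
  subst ha
  simp [kN] at hlt

theorem fam_contra [Finite G] {n d r a b : ℕ} (hn0 : 0 < n) (hn : ∀ g : G, addOrderOf g ∣ n)
    (hd : 1 ≤ d) (hrd : r ≤ d) (hnd : n ≤ d + 1)
    (hp : ∀ p, p.Prime → Nat.card {x : G // p • x = 0} ≤ p ^ r)
    (hF : Fam G d a b) (hab : b < a) : False := by
  obtain ⟨G0, hHD, s, t, hs, ht, hst, hG0, hpos, hle⟩ := fam_extract hF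
  have lcn : ∀ A, ZAtom A → (∀ g ∈ A, g ∈ G0) → n ≤ kN n A := by
    intro A hA hA0
    by_contra hlt
    push Not at hlt
    have h2 := kN_one_lt hn0 hn hA hlt
    have h3 := kN_pos_of_mem hn0 (A := A) (fun g _ => hn g)
    have hm := hHD.kN_mod hA (fun g hg => by simpa using hA0 g hg) (fun g _ => hn g)
    have := (Nat.modEq_iff_dvd' hlt.le).1 hm
    have := Nat.le_of_dvd (by omega) this
    omega
  have key := main_lcn hn0 hd (by omega) hrd hp G0 (fun g _ => hn g) hHD lcn
  have h1 := kN_fac_eq (n := n) (s := s) (fun A hA => key A (hs A hA) (over_of_mem rfl hG0 A hA))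
  have h2 := kN_fac_eq (n := n) (s := t)
    (fun A hA => key A (ht A hA) (over_of_mem hst.symm hG0 A hA))
  rw [hst, h2] at h1
  have h3 : t.card = s.card := Nat.eq_of_mul_eq_mul_left hn0 h1
  rw [h3] at hle
  have := Nat.le_of_mul_le_mul_right hle hpos
  omega

theorem kN_eq_three [Finite G] {n : ℕ} (hn5 : 5 ≤ n) (hn : ∀ g : G, addOrderOf g ∣ n)
    {A : Multiset G} (hA : ZAtom A) (hlt : kN n A < n) (hm : kN n A ≡ n [MOD (n - 3)]) :
    kN n A = 3 := by
  have h2 := kN_one_lt (by omega) hn hA hlt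
  have h3 := kN_pos_of_mem (n := n) (by omega) (A := A) (fun g _ => hn g)
  obtain ⟨c, hc⟩ := (Nat.modEq_iff_dvd' hlt.le).1 hm
  rcases c with _ | _ | c
  · omega
  · omega
  · have : (n - 3) * 2 ≤ (n - 3) * (c + 1 + 1) := Nat.mul_le_mul_left _ (by omega)
    omega

theorem small_atom [Finite G] {n : ℕ} (hn5 : 5 ≤ n) (hn : ∀ g : G, addOrderOf g ∣ n)
    {A : Multiset G} (hA : ZAtom A) (h3 : kN n A = 3) :
    A.card = 3 ∧ ∀ g ∈ A, addOrderOf g = n := by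
  have h2 := kN_one_lt (by omega) hn hA (by omega)
  have hc := kN_pos_of_mem (n := n) (by omega) (A := A) (fun g _ => hn g)
  have hcard : A.card = 3 := by
    by_contra hne
    have h2' : A.card = 2 := by omega
    obtain ⟨x, y, rfl⟩ := Multiset.card_eq_two.1 h2'
    have hxy : x + y = 0 := by simpa using hA.2.1
    have : y = -x := by rw [eq_neg_iff_add_eq_zero, add_comm]; exact hxy
    subst this
    simp [kN] at h3
    omega
  refine ⟨hcard, fun g hg => ?_⟩
  obtain ⟨B, rfl⟩ := Multiset.exists_cons_of_mem hg
  have hB := kN_pos_of_mem (n := n) (by omega) (A := B) (fun g _ => hn g)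
  have e : kN n (g ::ₘ B) = n / addOrderOf g + kN n B := by simp [kN]
  rw [Multiset.card_cons] at hcard
  obtain ⟨c, hc⟩ := hn g
  have hpos := addOrderOf_pos g
  have e2 : n / addOrderOf g = c := by
    rw [hc]; exact Nat.mul_div_cancel_left _ hpos
  have : c = 1 := by
    have : c ≠ 0 := by rintro rfl; omega
    omega
  rw [this] at hc; omega

theorem case1 [Finite G] {n r : ℕ} (hn5 : 5 ≤ n) (hn : ∀ g : G, addOrderOf g ∣ n)
    (hr : r ≤ n - 3)
    (hp : ∀ p, p.Prime → Nat.card {x : G // p • x = 0} ≤ p ^ r)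
    (hF : Fam G (n - 3) (n - 1) 2) : False := by
  obtain ⟨G0, hHD, s, t, hs, ht, hst, hG0, hpos, hle⟩ := fam_extract hF
  have small : ∀ A, ZAtom A → (∀ g ∈ A, g ∈ G0) → kN n A < n → kN n A = 3 := by
    intro A hA hA0 hlt
    exact kN_eq_three hn5 hn hA hlt
      (hHD.kN_mod hA (fun g hg => by simpa using hA0 g hg) (fun g _ => hn g))
  by_cases hbad : ∃ A, ZAtom A ∧ (∀ g ∈ A, g ∈ G0) ∧ n < kN n A
  · obtain ⟨A, hA, hA0, hlt⟩ := hbad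
    have hsub : (↑A.toFinset : Set G) ⊆ ↑G0 := by
      intro g hg
      simp at hg
      exact hA0 g hg
    have hU : ∃ U, ZAtom U ∧ (∀ g ∈ U, g ∈ A) ∧ kN n U < n := by
      by_contra hno
      push Not at hno
      have := main_lcn (n := n) (d := n - 3) (by omega) (by omega) (by omega) hr hp A.toFinset
        (fun g _ => hn g) (hHD.mono hsub)
        (fun U hU hUA => hno U hU (fun g hg => by simpa using hUA g hg)) A hA (by simp)
      omega
    obtain ⟨U, hU, hUA, hUlt⟩ := hU
    have hU3 := small U hU (fun g hg => hA0 g (hUA g hg)) hUlt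
    obtain ⟨hUc, hUo⟩ := small_atom hn5 hn hU hU3
    have hnd : ¬ U.Nodup := by
      intro hnd
      have := hU.le_atom hA ((Multiset.le_iff_subset hnd).2 hUA)
      rw [this] at hUlt; omega
    rw [Multiset.nodup_iff_count_le_one] at hnd
    push Not at hnd
    obtain ⟨g, hg⟩ := hnd
    have hle2 : Multiset.replicate 2 g ≤ U := (vertex_le_iff _ _ _).2 hg
    obtain ⟨C, rfl⟩ := Multiset.le_iff_exists_add.1 hle2
    have hC1 : C.card = 1 := by simp at hUc; omega
    obtain ⟨x, rfl⟩ := Multiset.card_eq_one.1 hC1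
    have hsum : 2 • g + x = 0 := by
      have := hU.2.1
      rwa [Multiset.sum_add, Multiset.sum_replicate, Multiset.sum_singleton] at this
    have hx : x = -(2 • g) := by rw [eq_neg_iff_add_eq_zero, add_comm]; exact hsum
    have hog : addOrderOf g = n := hUo g (by simp)
    have hox : addOrderOf x = n := hUo x (by simp)
    have hg0 : g ∈ G0 := hA0 g (hUA g (by simp))
    have hx0 : x ∈ G0 := hA0 x (hUA x (by simp))
    have h3x : ¬ (3 • x = 0) := by
      intro h
      have := addOrderOf_dvd_of_nsmul_eq_zero h
      rw [hox] at this
      have := Nat.le_of_dvd (by norm_num) this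
      omega
    have hgx : g ≠ x := by
      intro h
      apply h3x
      rw [h] at hsum
      rw [succ_nsmul]; exact hsum
    have hodd : n % 2 = 1 := by
      by_contra hev
      have h2n : 2 ∣ n := by omega
      have : (n / 2) • x = 0 := by
        rw [hx, smul_neg, smul_smul, Nat.div_mul_cancel h2n, ← hog, addOrderOf_nsmul_eq_zero,
          neg_zero]
      have := addOrderOf_dvd_of_nsmul_eq_zero this
      rw [hox] at this
      have := Nat.le_of_dvd (by omega) this
      omega
    set X : Multiset G := {g} + Multiset.replicate ((n + 1) / 2) x with hX
    have hXs : X.sum = 0 := by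
      have e : (n + 1) / 2 * 2 = n + 1 := by omega
      simp only [hX, Multiset.sum_add, Multiset.sum_singleton, Multiset.sum_replicate]
      rw [hx, smul_neg, smul_smul, e, succ_nsmul]
      have hng : n • g = 0 := by rw [← hog]; exact addOrderOf_nsmul_eq_zero g
      rw [hng]; simp
    have hXk : kN n X = (n + 1) / 2 + 1 := by
      rw [hX, kN_add]
      simp [kN, hog, hox, Nat.div_self (show 0 < n by omega)]
      omega
    obtain ⟨w, hw, hwX⟩ := exists_fac X hXs
    have hXG : ∀ h ∈ X, h ∈ G0 := by
      intro h hh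
      simp only [hX, Multiset.mem_add, Multiset.mem_singleton, Multiset.mem_replicate] at hh
      rcases hh with rfl | ⟨_, rfl⟩
      · exact hg0
      · exact hx0
    have hw3 : ∀ V ∈ w, kN n V = 3 := by
      intro V hV
      apply small V (hw V hV) (over_of_mem hwX hXG V hV)
      have := kN_le_of_le (n := n) (le_of_mem_fac hV)
      rw [hwX, hXk] at this
      omega
    have hwk : kN n w.sum = 3 * w.card := by
      rw [kN_sum, Multiset.map_congr rfl hw3]
      simp [mul_comm]
    rw [hwX, hXk] at hwk
    have hcnt : X.count g = 1 := by
      rw [hX, Multiset.count_add, Multiset.count_replicate]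
      simp [Ne.symm hgx]
    have hV : ∃ V ∈ w, g ∉ V := by
      by_contra hall
      push Not at hall
      have : w.card ≤ w.sum.count g := by
        clear hwX hw hw3 hwk
        induction w using Multiset.induction_on with
        | empty => simp
        | cons V w ih =>
          have h1 := Multiset.one_le_count_iff_mem.2 (hall V (by simp))
          have h2 := ih (fun B hB => hall B (by simp [hB]))
          rw [Multiset.sum_cons, Multiset.count_add, Multiset.card_cons]
          omega
      rw [hwX, hcnt] at this
      omega
    obtain ⟨V, hVw, hgV⟩ := hV
    obtain ⟨hVc, _⟩ := small_atom hn5 hn (hw V hVw) (hw3 V hVw)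
    have hVx : V = Multiset.replicate 3 x := by
      rw [Multiset.eq_replicate]
      refine ⟨hVc, fun y hy => ?_⟩
      have : y ∈ X := hwX ▸ Multiset.mem_of_le (le_of_mem_fac hVw) hy
      simp only [hX, Multiset.mem_add, Multiset.mem_singleton, Multiset.mem_replicate] at this
      rcases this with rfl | ⟨_, rfl⟩
      · exact absurd hy hgV
      · rfl
    have := (hw V hVw).2.1
    rw [hVx, Multiset.sum_replicate] at this
    exact h3x this
  · push Not at hbad
    have h1 := kN_fac_le (n := n) (s := s)
      (fun A hA => hbad A (hs A hA) (over_of_mem rfl hG0 A hA))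
    have h2 := kN_fac_ge' (n := n) (c := 3) (s := t) (fun A hA => by
      rcases lt_or_ge (kN n A) n with h | h
      · exact (small A (ht A hA) (over_of_mem hst.symm hG0 A hA) h).ge
      · omega)
    rw [← hst] at h2
    obtain ⟨m, rfl⟩ : ∃ m, n = m + 4 := ⟨n - 4, by omega⟩
    have e : m + 4 - 1 = m + 3 := by omega
    rw [e] at hle
    nlinarith

end CasePart

section GroupPart
variable {G : Type*} [AddCommGroup G] {ι : Type*} [Fintype ι]

theorem Indep.comp {κ : Type*} [Fintype κ] {e : ι → G} {o : ι → ℕ} (h : Indep e o) {f : κ → ι}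
    (hf : Function.Injective f) : Indep (fun k => e (f k)) (fun k => o (f k)) := by
  refine ⟨fun k => h.two_le _, fun k => h.ord _, fun c hc k => ?_⟩
  have := h.ind (Function.extend f c 0) (by
    rw [← hc]
    symm
    apply Fintype.sum_of_injective f hf
    · intro i hi
      rw [Function.extend_apply']
      · simp
      · simpa using hi
    · intro k
      rw [hf.extend_apply]) (f k)
  rwa [hf.extend_apply] at this

theorem Indep.scale {e : ι → G} {o : ι → ℕ} (h : Indep e o) {m : ℕ} (hm : 2 ≤ m)
    (hd : ∀ i, m ∣ o i) : Indep (fun i => (o i / m) • e i) (fun _ => m) := by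
  refine ⟨fun _ => hm, fun i => ?_, fun c hc i => ?_⟩
  · rw [smul_smul, Nat.mul_div_cancel' (hd i)]; exact h.ord i
  · have h1 := h.ind (fun i => c i * ((o i / m : ℕ) : ℤ)) (by
      rw [← hc]
      apply Finset.sum_congr rfl
      intro i _
      rw [mul_smul, natCast_zsmul]) i
    obtain ⟨q, hq⟩ := hd i
    have ho := h.two_le i
    have hq0 : q ≠ 0 := by rintro rfl; omega
    rw [hq, Nat.mul_div_cancel_left _ (by omega)] at h1
    push_cast at h1
    exact Int.dvd_of_mul_dvd_mul_right (by exact_mod_cast hq0) h1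

theorem indep_basis {n : ι → ℕ} (hn : ∀ i, 1 < n i) (φ : G ≃+ (∀ i, ZMod (n i))) :
    Indep (fun i => φ.symm (Pi.single i 1)) n := by
  refine ⟨fun i => hn i, fun i => ?_, fun c hc i => ?_⟩
  · rw [← map_nsmul, ← Pi.single_smul]
    simp
  · have h1 := congrArg φ hc
    simp only [map_sum, map_zsmul, AddEquiv.apply_symm_apply, map_zero] at h1
    have h2 := congrFun h1 i
    simp only [Finset.sum_apply, Pi.smul_apply, Pi.zero_apply] at h2
    rw [Finset.sum_eq_single i] at h2
    · simp at h2
      exact (ZMod.intCast_zmod_eq_zero_iff_dvd _ _).1 h2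
    · intro j _ hj
      rw [Pi.single_eq_of_ne hj.symm]; simp
    · simp

theorem ord_dvd {n : ι → ℕ} {N : ℕ} (hN : ∀ i, n i ∣ N) (φ : G ≃+ (∀ i, ZMod (n i))) (g : G) :
    N • g = 0 := by
  apply φ.injective
  rw [map_nsmul, map_zero]
  funext i
  simp only [Pi.smul_apply, Pi.zero_apply, nsmul_eq_mul]
  rw [(ZMod.natCast_eq_zero_iff N (n i)).2 (hN i), zero_mul]

theorem torsion_card [Finite G] {n : ι → ℕ} (hn : ∀ i, 1 < n i) (φ : G ≃+ (∀ i, ZMod (n i)))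
    (p : ℕ) (hp : p.Prime) : Nat.card {x : G // p • x = 0} ≤ p ^ Fintype.card ι := by
  have hne : ∀ i, NeZero (n i) := fun i => ⟨by have := hn i; omega⟩
  have h1 : Nat.card {x : G // p • x = 0} ≤ Nat.card (∀ i, {y : ZMod (n i) // p • y = 0}) := by
    refine Nat.card_le_card_of_injective
      (fun x i => ⟨φ x.1 i, by
        have := congrFun (congrArg φ x.2) i
        simpa using this⟩) ?_
    intro x y hxy
    apply Subtype.ext
    apply φ.injective
    funext i
    have := congrFun hxy i
    exact congrArg Subtype.val this
  refine h1.trans ?_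
  rw [Nat.card_pi]
  calc ∏ i, Nat.card {y : ZMod (n i) // p • y = 0} ≤ ∏ _i : ι, p := by
        apply Finset.prod_le_prod'
        intro i _
        rw [Nat.card_eq_fintype_card, Fintype.card_subtype]
        exact IsAddCyclic.card_nsmul_eq_zero_le hp.pos
    _ = _ := by simp

theorem exponent_eq {N : ℕ} (h : ∀ g : G, N • g = 0) {g : G} (hg : addOrderOf g = N) :
    AddMonoid.exponent G = N := by
  apply Nat.dvd_antisymm
  · exact AddMonoid.exponent_dvd_of_forall_nsmul_eq_zero h
  · rw [← hg]; exact AddMonoid.addOrder_dvd_exponent g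

end GroupPart

section FourPart
variable {G : Type*} [AddCommGroup G]

theorem len_transfer {G G' : Type*} [AddCommGroup G] [AddCommGroup G']
    (hL : systemL (Set.univ : Set G) = systemL (Set.univ : Set G'))
    {s t : Multiset (Multiset G')} (hs : ZFac s) (ht : ZFac t) (hst : s.sum = t.sum) :
    ∃ s' t' : Multiset (Multiset G), ZFac s' ∧ ZFac t' ∧ s'.sum = t'.sum ∧
      s'.card = s.card ∧ t'.card = t.card := by
  have h1 : lengthSet Set.univ s.sum ∈ systemL (Set.univ : Set G') :=
    ⟨s.sum, ⟨by simp, hs.sum_sum⟩, rfl⟩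
  rw [← hL] at h1
  obtain ⟨B, _, hBL⟩ := h1
  have hs1 := (mem_lengthSet_iff s.sum s.card).2 ⟨s, hs, rfl, rfl⟩
  have ht1 := (mem_lengthSet_iff s.sum t.card).2 ⟨t, ht, hst.symm, rfl⟩
  rw [hBL, mem_lengthSet_iff] at hs1 ht1
  obtain ⟨s', a1, a2, a3⟩ := hs1
  obtain ⟨t', b1, b2, b3⟩ := ht1
  exact ⟨s', t', a1, b1, by rw [a2, b2], a3, b3⟩

theorem remove_zero {s t : Multiset (Multiset G)} (ht : ZFac t)
    (hst : s.sum = t.sum) (h0 : ({0} : Multiset G) ∈ s) :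
    ∃ s' t', s = {0} ::ₘ s' ∧ t = {0} ::ₘ t' ∧ s'.sum = t'.sum := by
  obtain ⟨s', rfl⟩ := Multiset.exists_cons_of_mem h0
  have hm : (0 : G) ∈ t.sum := by rw [← hst]; simp
  obtain ⟨T, hT, h0T⟩ := Multiset.mem_join.1 hm
  have hT0 : T = {0} := by
    by_contra h
    exact atom_ne_zero_of_ne (ht T hT) h h0T
  subst hT0
  obtain ⟨t', rfl⟩ := Multiset.exists_cons_of_mem hT
  refine ⟨s', t', rfl, rfl, ?_⟩
  rw [Multiset.sum_cons, Multiset.sum_cons] at hst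
  exact add_left_cancel hst

theorem two_le_card {A : Multiset G} (hA : ZAtom A) (h : A ≠ {0}) : 2 ≤ A.card := by
  by_contra hlt
  have hc : A.card ≠ 0 := fun h0 => hA.1 (Multiset.card_eq_zero.1 h0)
  obtain ⟨a, rfl⟩ := Multiset.card_eq_one.1 (show A.card = 1 by omega)
  have ha : a = 0 := by simpa using hA.2.1
  exact h (by rw [ha])

theorem atom_card_le [Finite G] {A : Multiset G} (hA : ZAtom A) : A.card ≤ Nat.card G := by
  by_contra hlt
  obtain ⟨a, ha⟩ := Multiset.exists_mem_of_ne_zero hA.1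
  obtain ⟨P, rfl⟩ := Multiset.exists_cons_of_mem ha
  rw [Multiset.card_cons] at hlt
  obtain ⟨Q, hQ, hQ0, hQs⟩ := exists_zero_subsum (id : G → G) P (by omega)
  rw [Multiset.map_id] at hQs
  rcases hA.2.2 Q (hQ.trans (Multiset.le_cons_self _ _)) hQs with h | h
  · exact hQ0 h
  · have := Multiset.card_le_card hQ
    rw [h, Multiset.card_cons] at this
    omega

theorem card_sum_ge {t : Multiset (Multiset G)} {c : ℕ} (h : ∀ A ∈ t, c ≤ A.card) :
    c * t.card ≤ t.sum.card := by
  induction t using Multiset.induction_on with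
  | empty => simp
  | cons A s ih =>
    have h1 := h A (by simp)
    have h2 := ih (fun B hB => h B (by simp [hB]))
    rw [Multiset.sum_cons, Multiset.card_add, Multiset.card_cons, mul_add]
    omega

theorem card_sum_le {t : Multiset (Multiset G)} {c : ℕ} (h : ∀ A ∈ t, A.card ≤ c) :
    t.sum.card ≤ c * t.card := by
  induction t using Multiset.induction_on with
  | empty => simp
  | cons A s ih =>
    have h1 := h A (by simp)
    have h2 := ih (fun B hB => h B (by simp [hB]))
    rw [Multiset.sum_cons, Multiset.card_add, Multiset.card_cons, mul_add]
    omega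

theorem zero_mem_symm {s t : Multiset (Multiset G)} (ht : ZFac t)
    (hst : s.sum = t.sum) (h0 : ({0} : Multiset G) ∈ s) : ({0} : Multiset G) ∈ t := by
  obtain ⟨s', t', _, h, _⟩ := remove_zero ht hst h0
  rw [h]; simp

theorem len_bound [Finite G] (h4 : Nat.card G = 4) {s t : Multiset (Multiset G)} (hs : ZFac s)
    (ht : ZFac t) (hst : s.sum = t.sum) (h2 : s.card = 2) : t.card ≤ 4 := by
  by_cases h0 : ({0} : Multiset G) ∈ s
  · obtain ⟨s', t', rfl, rfl, he⟩ := remove_zero ht hst h0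
    rw [Multiset.card_cons] at h2 ⊢
    obtain ⟨A, rfl⟩ := Multiset.card_eq_one.1 (show s'.card = 1 by omega)
    rw [Multiset.sum_singleton] at he
    have := fac_of_atom (hs A (by simp)) (ZFac.mono (Multiset.le_cons_self _ _) ht) he.symm
    rw [this]; simp
  · have h0t : ({0} : Multiset G) ∉ t := fun h => h0 (zero_mem_symm hs hst.symm h)
    have a1 := card_sum_ge (t := t) (c := 2)
      (fun A hA => two_le_card (ht A hA) (fun h => h0t (h ▸ hA)))
    have a2 := card_sum_le (t := s) (c := 4) (fun A hA => h4 ▸ atom_card_le (hs A hA))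
    rw [hst] at a2
    omega

theorem no_three_six [Finite G] (φ : G ≃+ ZMod 4) {s t : Multiset (Multiset G)} (hs : ZFac s)
    (ht : ZFac t) (hst : s.sum = t.sum) (h3 : s.card = 3) (h6 : t.card = 6) : False := by
  have h4 : Nat.card G = 4 := by rw [Nat.card_congr φ.toEquiv, Nat.card_zmod]
  by_cases h0 : ({0} : Multiset G) ∈ s
  · obtain ⟨s', t', rfl, rfl, he⟩ := remove_zero ht hst h0
    rw [Multiset.card_cons] at h3 h6
    have := len_bound h4 (ZFac.mono (Multiset.le_cons_self _ _) hs)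
      (ZFac.mono (Multiset.le_cons_self _ _) ht) he (by omega)
    omega
  have h0t : ({0} : Multiset G) ∉ t := fun h => h0 (zero_mem_symm hs hst.symm h)
  have t2 : ∀ A ∈ t, 2 ≤ A.card := fun A hA => two_le_card (ht A hA) (fun h => h0t (h ▸ hA))
  have s4 : ∀ A ∈ s, A.card ≤ 4 := fun A hA => h4 ▸ atom_card_le (hs A hA)
  have a1 := card_sum_ge t2
  have a2 := card_sum_le s4
  rw [hst] at a2
  have t2' : ∀ A ∈ t, A.card = 2 := by
    intro A hA
    have := t2 A hA
    obtain ⟨t', rfl⟩ := Multiset.exists_cons_of_mem hA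
    have := card_sum_ge (t := t') (c := 2) (fun B hB => t2 B (by simp [hB]))
    rw [Multiset.sum_cons, Multiset.card_add] at a2
    rw [Multiset.card_cons] at h6
    omega
  have s4' : ∀ A ∈ s, A.card = 4 := by
    intro A hA
    have := s4 A hA
    rw [← hst] at a1
    obtain ⟨s', rfl⟩ := Multiset.exists_cons_of_mem hA
    have := card_sum_le (t := s') (c := 4) (fun B hB => s4 B (by simp [hB]))
    rw [Multiset.sum_cons, Multiset.card_add] at a1
    rw [Multiset.card_cons] at h3
    omega
  have dec : ∀ a b c d : ZMod 4, a + b + c + d = 0 → a ≠ 0 → b ≠ 0 → c ≠ 0 → d ≠ 0 →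
      a + b ≠ 0 → a + c ≠ 0 → a + d ≠ 0 → b + c ≠ 0 →
      b = a ∧ c = a ∧ d = a ∧ (a = 1 ∨ a = 3) := by decide
  have shape : ∀ A ∈ s, ∃ a, A = Multiset.replicate 4 a ∧ (φ a = 1 ∨ φ a = 3) := by
    intro A hA
    have hc := s4' A hA
    have hat := hs A hA
    have hz : (0 : G) ∉ A := atom_ne_zero_of_ne hat (fun h => h0 (h ▸ hA))
    obtain ⟨a, ha⟩ := Multiset.exists_mem_of_ne_zero hat.1
    obtain ⟨B, rfl⟩ := Multiset.exists_cons_of_mem ha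
    obtain ⟨b, c, d, rfl⟩ := Multiset.card_eq_three.1 (show B.card = 3 by simpa using hc)
    have hsum : a + b + c + d = 0 := by
      have := hat.2.1
      simp at this
      rw [← this]; abel
    have pr : ∀ x y : G, ({x, y} : Multiset G) ≤ a ::ₘ {b, c, d} → φ x + φ y ≠ 0 := by
      intro x y hle h
      have hxy : x + y = 0 := φ.injective (by rw [map_add, h, map_zero])
      rcases hat.2.2 _ hle (by simpa using hxy) with h | h
      · simp at h
      · have := congrArg Multiset.card h
        simp at this
    have nz : ∀ x : G, x ∈ a ::ₘ ({b, c, d} : Multiset G) → φ x ≠ 0 := by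
      intro x hx h
      have : x = 0 := φ.injective (by rw [h, map_zero])
      exact hz (this ▸ hx)
    have le1 : ∀ x y u v : G, ({x, y} : Multiset G) ≤ {x} + {y} + {u} + {v} := by
      intro x y u v
      have : ({x, y} : Multiset G) = {x} + {y} := rfl
      rw [this, add_assoc]
      exact Multiset.le_add_right _ _
    have eA : a ::ₘ ({b, c, d} : Multiset G) = {a} + {b} + {c} + {d} := by
      simp [Multiset.singleton_add, add_assoc]
    obtain ⟨e1, e2, e3, e4⟩ := dec (φ a) (φ b) (φ c) (φ d)
      (by rw [← map_add, ← map_add, ← map_add, hsum, map_zero])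
      (nz a (by simp)) (nz b (by simp)) (nz c (by simp)) (nz d (by simp))
      (pr a b (by rw [eA]; exact le1 a b c d))
      (pr a c (by
        rw [eA, show ({a} + {b} + {c} + {d} : Multiset G) = {a} + {c} + {b} + {d} by abel]
        exact le1 a c b d))
      (pr a d (by
        rw [eA, show ({a} + {b} + {c} + {d} : Multiset G) = {a} + {d} + {b} + {c} by abel]
        exact le1 a d b c))
      (pr b c (by
        rw [eA, show ({a} + {b} + {c} + {d} : Multiset G) = {b} + {c} + {a} + {d} by abel]
        exact le1 b c a d))
    have f1 := φ.injective e1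
    have f2 := φ.injective e2
    have f3 := φ.injective e3
    subst f1 f2 f3
    exact ⟨_, rfl, e4⟩
  have cs : 4 ∣ s.sum.countP (fun g => φ g = 1) := by
    have : ∀ w : Multiset (Multiset G), (∀ A ∈ w, ∃ a, A = Multiset.replicate 4 a) →
        4 ∣ w.sum.countP (fun g => φ g = 1) := by
      intro w hw
      induction w using Multiset.induction_on with
      | empty => simp
      | cons A w ih =>
        rw [Multiset.sum_cons, Multiset.countP_add]
        refine dvd_add ?_ (ih fun B hB => hw B (by simp [hB]))
        obtain ⟨a, rfl⟩ := hw A (by simp)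
        have : Multiset.replicate 4 a = 4 • ({a} : Multiset G) := by
          rw [Multiset.nsmul_singleton]
        rw [this, Multiset.countP_nsmul]
        exact dvd_mul_right _ _
    exact this s (fun A hA => (shape A hA).imp fun a h => h.1)
  have ct : ∀ A ∈ t, A.countP (fun g => φ g = 1) = 1 := by
    intro A hA
    obtain ⟨x, y, rfl⟩ := Multiset.card_eq_two.1 (t2' A hA)
    have hxy : φ x + φ y = 0 := by
      have := (ht _ hA).2.1
      simp at this
      rw [← map_add, this, map_zero]
    have hx : φ x = 1 ∨ φ x = 3 := by
      have : x ∈ s.sum := by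
        rw [hst]; exact Multiset.mem_of_le (le_of_mem_fac hA) (by simp)
      obtain ⟨B, hB, hxB⟩ := Multiset.mem_join.1 this
      obtain ⟨a, rfl, ha⟩ := shape B hB
      rw [Multiset.eq_of_mem_replicate hxB]; exact ha
    have dec2 : ∀ u v : ZMod 4, u + v = 0 → (u = 1 ∨ u = 3) →
        (u = 1 ∧ v ≠ 1) ∨ (u ≠ 1 ∧ v = 1) := by decide
    have e : ({x, y} : Multiset G) = {x} + {y} := rfl
    rw [e, Multiset.countP_add, ← Multiset.cons_zero, ← Multiset.cons_zero,
      Multiset.countP_cons, Multiset.countP_cons]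
    rcases dec2 _ _ hxy hx with ⟨h1, h2⟩ | ⟨h1, h2⟩ <;> simp [h1, h2]
  have ct6 : t.sum.countP (fun g => φ g = 1) = t.card := by
    clear h6 ht hst h0t t2 a1 a2 t2'
    induction t using Multiset.induction_on with
    | empty => simp
    | cons A w ih =>
      rw [Multiset.sum_cons, Multiset.countP_add, ct A (by simp),
        ih (fun B hB => ct B (by simp [hB])), Multiset.card_cons, add_comm]
  rw [hst, ct6, h6] at cs
  omega

end FourPart

section FinalPart
variable {G : Type*} [AddCommGroup G]

theorem ZAtom.neg {A : Multiset G} (hA : ZAtom A) : ZAtom (A.map (fun x => -x)) := by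
  refine ⟨?_, ?_, ?_⟩
  · intro h
    exact hA.1 (Multiset.map_eq_zero.1 h)
  · rw [Multiset.sum_map_neg', hA.2.1, neg_zero]
  · intro T hT hT0
    have h1 : T.map (fun x => -x) ≤ A := by
      have := Multiset.map_le_map (f := fun x : G => -x) hT
      rwa [Multiset.map_map, show ((fun x : G => -x) ∘ fun x => -x) = id by
        funext x; simp, Multiset.map_id] at this
    have h2 : T = (T.map (fun x => -x)).map (fun x => -x) := by
      rw [Multiset.map_map, show ((fun x : G => -x) ∘ fun x => -x) = id by
        funext x; simp, Multiset.map_id]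
    rcases hA.2.2 _ h1 (by rw [Multiset.sum_map_neg', hT0, neg_zero]) with h | h
    · left; exact Multiset.map_eq_zero.1 h
    · right; rw [h2, h]

/-- `U * (-U)` has lengths `2` and `|U|`. -/
theorem pair_lengths {U : Multiset G} (hU : ZAtom U) (hU2 : U ≠ {0}) :
    ∃ s t : Multiset (Multiset G), ZFac s ∧ ZFac t ∧ s.sum = t.sum ∧ s.card = 2 ∧
      t.card = U.card := by
  refine ⟨{U, U.map (fun x => -x)}, U.map (fun x => {x, -x}), ?_, ?_, ?_, by simp, by simp⟩
  · intro A hA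
    simp at hA
    rcases hA with rfl | rfl
    · exact hU
    · exact hU.neg
  · intro A hA
    obtain ⟨x, hx, rfl⟩ := Multiset.mem_map.1 hA
    exact pair_atom (fun h => atom_ne_zero_of_ne hU hU2 (h ▸ hx))
  · have e : ∀ V : Multiset G, V + V.map (fun x => -x) =
        (V.map (fun x => ({x, -x} : Multiset G))).sum := by
      intro V
      induction V using Multiset.induction_on with
      | empty => simp
      | cons a V ih =>
        rw [Multiset.map_cons, Multiset.map_cons, Multiset.sum_cons, ← ih]
        have : ({a, -a} : Multiset G) = {a} + {-a} := rfl
        rw [this, ← Multiset.singleton_add, ← Multiset.singleton_add]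
        abel
    rw [← e]
    simp

theorem three_six_lengths {e : Fin 3 → G} (h : Indep e (fun _ => 2)) :
    ∃ s t : Multiset (Multiset G), ZFac s ∧ ZFac t ∧ s.sum = t.sum ∧ s.card = 3 ∧
      t.card = 6 := by
  obtain ⟨a, ha⟩ : ∃ a, a = e 0 := ⟨_, rfl⟩
  obtain ⟨b, hb⟩ : ∃ a, a = e 1 := ⟨_, rfl⟩
  obtain ⟨c, hc⟩ : ∃ a, a = e 2 := ⟨_, rfl⟩
  have a2 : a + a = 0 := by rw [ha, ← two_nsmul]; exact h.ord 0
  have b2 : b + b = 0 := by rw [hb, ← two_nsmul]; exact h.ord 1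
  have c2 : c + c = 0 := by rw [hc, ← two_nsmul]; exact h.ord 2
  have key : ∀ x y z : ℤ, x • a + y • b + z • c = 0 → (2 : ℤ) ∣ x ∧ (2 : ℤ) ∣ y ∧ (2 : ℤ) ∣ z := by
    intro x y z hxyz
    have := h.ind ![x, y, z] (by
      rw [Fin.sum_univ_three]; simpa [ha, hb, hc] using hxyz)
    exact ⟨by simpa using this 0, by simpa using this 1, by simpa using this 2⟩
  have mk : ∀ x y z : G, x + x = 0 → y + y = 0 → z + z = 0 →
      (∀ i j k : ℤ, i • x + j • y + k • z = 0 → (2 : ℤ) ∣ i ∧ (2 : ℤ) ∣ j ∧ (2 : ℤ) ∣ k) →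
      ZAtom ({x + y + z} + ({x} + {y} + {z}) : Multiset G) := by
    intro x y z hx hy hz hk
    have hI : Indep ![x, y, z] (fun _ => 2) := by
      refine ⟨fun _ => le_rfl, ?_, ?_⟩
      · intro i
        fin_cases i <;> simp [two_nsmul, hx, hy, hz]
      · intro cc hcc i
        rw [Fin.sum_univ_three] at hcc
        obtain ⟨h1, h2, h3⟩ := hk _ _ _ hcc
        fin_cases i
        · exact h1
        · exact h2
        · exact h3
    have := hI.bigAtom_atom
    rw [bigAtom, Fin.sum_univ_three, Fin.sum_univ_three] at this
    simpa using this
  have A1 := mk a b c a2 b2 c2 key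
  have ac2 : (a + c) + (a + c) = 0 := by
    rw [show (a + c) + (a + c) = (a + a) + (c + c) by abel, a2, c2, add_zero]
  have bc2 : (b + c) + (b + c) = 0 := by
    rw [show (b + c) + (b + c) = (b + b) + (c + c) by abel, b2, c2, add_zero]
  have abc2 : (a + b + c) + (a + b + c) = 0 := by
    rw [show (a + b + c) + (a + b + c) = (a + a) + (b + b) + (c + c) by abel, a2, b2, c2]; simp
  have A2 := mk a b (a + c) a2 b2 ac2 (by
    intro i j k hijk
    have := key (i + k) j k (by rw [← hijk]; module)
    omega)
  have A3 := mk c (a + c) (b + c) c2 ac2 bc2 (by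
    intro i j k hijk
    have := key j k (i + j + k) (by rw [← hijk]; module)
    omega)
  have e2 : a + b + (a + c) = b + c := by
    rw [show a + b + (a + c) = (a + a) + (b + c) by abel, a2, zero_add]
  have e3 : c + (a + c) + (b + c) = a + b + c := by
    rw [show c + (a + c) + (b + c) = (c + c) + (a + b + c) by abel, c2, zero_add]
  rw [e2] at A2
  rw [e3] at A3
  have sq : ∀ x : G, x + x = 0 → x ≠ 0 → ZAtom ({x} + {x} : Multiset G) := by
    intro x hx hx0
    have := pair_atom hx0
    rw [neg_eq_of_add_eq_zero_left hx] at this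
    exact this
  have nz : ∀ x y z : ℤ, ¬ ((2 : ℤ) ∣ x ∧ (2 : ℤ) ∣ y ∧ (2 : ℤ) ∣ z) →
      x • a + y • b + z • c ≠ 0 := fun x y z hn h0 => hn (key x y z h0)
  have na : a ≠ 0 := by simpa using nz 1 0 0 (by omega)
  have nb : b ≠ 0 := by simpa using nz 0 1 0 (by omega)
  have nc : c ≠ 0 := by simpa using nz 0 0 1 (by omega)
  have nac : a + c ≠ 0 := by simpa using nz 1 0 1 (by omega)
  have nbc : b + c ≠ 0 := by simpa using nz 0 1 1 (by omega)
  have nabc : a + b + c ≠ 0 := by simpa using nz 1 1 1 (by omega)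
  refine ⟨_, _, ZFac.cons A1 (ZFac.cons A2 (ZFac.cons A3 ZFac.zero)),
    ZFac.cons (sq a a2 na) (ZFac.cons (sq b b2 nb) (ZFac.cons (sq c c2 nc)
      (ZFac.cons (sq _ ac2 nac) (ZFac.cons (sq _ bc2 nbc) (ZFac.cons (sq _ abc2 nabc)
        ZFac.zero))))), ?_, by simp, by simp⟩
  simp only [Multiset.sum_cons, Multiset.sum_zero]
  abel

theorem card_bigAtom {ι : Type*} [Fintype ι] (e : ι → G) (o : ι → ℕ) :
    (bigAtom e o).card = 1 + ∑ i, (o i - 1) := by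
  rw [bigAtom, Multiset.card_add, Multiset.card_sum]
  simp

end FinalPart

/-- If `G ≅ C_{n₁} ⊕ … ⊕ C_{n_r}` with `1 < n₁ ∣ … ∣ n_r`,
`D(G) ≥ 4`, `𝓛(G) = 𝓛(G')` and `r ≤ n_r − 3`, then `exp(G) = exp(G')` and
`r(G') ≤ n_r − 3`. -/
theorem stmt4 {G G' : Type*} [AddCommGroup G] [Fintype G] [AddCommGroup G'] [Fintype G']
    (r : ℕ) (hr : 0 < r) (n : Fin r → ℕ) (hn : ∀ i, 1 < n i)
    (hdvd : ∀ i j : Fin r, i ≤ j → n i ∣ n j)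
    (hG : Nonempty (G ≃+ (∀ i : Fin r, ZMod (n i))))
    (r' : ℕ) (hr' : 0 < r') (n' : Fin r' → ℕ) (hn' : ∀ i, 1 < n' i)
    (hdvd' : ∀ i j : Fin r', i ≤ j → n' i ∣ n' j)
    (hG' : Nonempty (G' ≃+ (∀ i : Fin r', ZMod (n' i))))
    (hD : 4 ≤ davenport G)
    (hL : systemL (Set.univ : Set G) = systemL (Set.univ : Set G'))
    (hcond : r ≤ n ⟨r - 1, by omega⟩ - 3) :
    AddMonoid.exponent G = AddMonoid.exponent G' ∧ r' ≤ n ⟨r - 1, by omega⟩ - 3 := by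
  obtain ⟨φ⟩ := hG
  obtain ⟨ψ⟩ := hG'
  obtain ⟨l, hl⟩ : ∃ l : Fin r, l = ⟨r - 1, by omega⟩ := ⟨_, rfl⟩
  obtain ⟨l', hl'⟩ : ∃ l : Fin r', l = ⟨r' - 1, by omega⟩ := ⟨_, rfl⟩
  rw [← hl] at hcond ⊢
  have hNd : ∀ i, n i ∣ n l := fun i => hdvd i l (by
    rw [hl, Fin.le_def]; have := i.2; simp; omega)
  have hNd' : ∀ i, n' i ∣ n' l' := fun i => hdvd' i l' (by
    rw [hl', Fin.le_def]; have := i.2; simp; omega)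
  have I := indep_basis hn φ
  obtain ⟨e', I'⟩ : ∃ e' : Fin r' → G', Indep e' n' := ⟨_, indep_basis hn' ψ⟩
  have E := ord_dvd hNd φ
  have E' := ord_dvd hNd' ψ
  have hg := I.addOrderOf_eq l
  have hg' := I'.addOrderOf_eq l'
  have hp : ∀ p, p.Prime → Nat.card {x : G // p • x = 0} ≤ p ^ r := by
    simpa using torsion_card hn φ
  have hp' : ∀ p, p.Prime → Nat.card {x : G' // p • x = 0} ≤ p ^ r' := by
    simpa using torsion_card hn' ψ
  rw [exponent_eq E hg, exponent_eq E' hg']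
  have oG : ∀ g : G, addOrderOf g ∣ n l := fun g => addOrderOf_dvd_of_nsmul_eq_zero (E g)
  have oG' : ∀ g : G', addOrderOf g ∣ n' l' := fun g => addOrderOf_dvd_of_nsmul_eq_zero (E' g)
  have hb2 := hn' l'
  have hrank : r' ≤ n l - 3 := by
    by_contra hlt
    rcases Nat.lt_or_ge (n l) 5 with h5 | h5
    · have hn4 : n l = 4 := by omega
      have hr1 : r = 1 := by omega
      have hcard : Nat.card G = 4 := by
        subst hr1
        rw [Nat.card_congr φ.toEquiv, Nat.card_pi, Fin.prod_univ_one, Nat.card_zmod,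
          ← hn4]
        congr 1
        exact Subsingleton.elim _ _
      rcases Nat.lt_or_ge (n' l') 3 with hb | hb
      · have hb' : n' l' = 2 := by omega
        rcases Nat.lt_or_ge r' 3 with hr3 | hr3
        · have hF := fam_cyclic hg (by omega)
          exact fam_contra (n := n' l') (by omega) oG' (by omega) (show r' ≤ n l - 2 by omega)
            (by omega) hp' (hF.transfer hL) (by omega)
        · have hall : ∀ i, n' i = 2 := fun i => by
            have h1 := Nat.le_of_dvd (by omega) (hNd' i)
            have := hn' i
            omega
          have I3 := I'.comp (Fin.castLE_injective hr3)
          have I3' : Indep (fun k => e' (Fin.castLE hr3 k))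
              (fun _ => 2) := by
            simpa only [hall] using I3
          obtain ⟨s, t, hs, ht, hst, h3, h6⟩ := three_six_lengths I3'
          obtain ⟨s', t', hs', ht', hst', h3', h6'⟩ := len_transfer hL hs ht hst
          have hcyc : IsAddCyclic G :=
            isAddCyclic_of_addOrderOf_eq_card _ (hg.trans (hn4.trans hcard.symm))
          have χ := zmodAddCyclicAddEquiv hcyc
          rw [hcard] at χ
          exact no_three_six χ.symm hs' ht' hst' (h3'.trans h3) (h6'.trans h6)
      · have hr2 : 2 ≤ r' := by omega
        obtain ⟨z, hz⟩ : ∃ l : Fin r', l = ⟨0, by omega⟩ := ⟨_, rfl⟩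
        have hzl : z ≠ l' := by
          rw [hz, hl', Ne, Fin.mk.injEq]; omega
        have hinj : Function.Injective (![z, l'] : Fin 2 → Fin r') := by
          intro i j hij
          fin_cases i <;> fin_cases j <;> simp_all
        have J := I'.comp hinj
        have hU := J.bigAtom_atom
        have hc := card_bigAtom (fun k => e' ((![z, l'] : Fin 2 → Fin r') k))
          (fun k => n' ((![z, l'] : Fin 2 → Fin r') k))
        rw [Fin.sum_univ_two] at hc
        simp only [Matrix.cons_val_zero, Matrix.cons_val_one] at hc
        have h5 : 5 ≤ 1 + (n' z - 1 + (n' l' - 1)) := by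
          have hz2 := hn' z
          obtain ⟨q, hq⟩ := hNd' z
          rcases Nat.lt_or_ge (n' z) 3 with h | h
          · have : n' z = 2 := by omega
            rw [this] at hq ⊢; omega
          · omega
        obtain ⟨s, t, hs, ht, hst, h2, hUc⟩ := pair_lengths hU (by
          intro h
          rw [h, Multiset.card_singleton] at hc
          omega)
        obtain ⟨s', t', hs', ht', hst', h2', hU'⟩ := len_transfer hL hs ht hst
        have := len_bound hcard hs' ht' hst' (h2'.trans h2)
        omega
    · obtain ⟨z, hz⟩ : ∃ l : Fin r', l = ⟨0, by omega⟩ := ⟨_, rfl⟩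
      have J := (I'.scale (m := n' z) (hn' z)
        (fun i => hdvd' z i (by rw [hz, Fin.le_def]; simp))).comp
        (Fin.castLE_injective (show n l - 2 ≤ r' by omega))
      have : Nontrivial (Fin (n l - 2)) := Fin.nontrivial_iff_two_le.2 (by omega)
      have hF := fam_indep J
      rw [Fintype.card_fin, show n l - 2 - 1 = n l - 3 by omega,
        show n l - 2 + 1 = n l - 1 by omega] at hF
      exact case1 h5 oG hcond hp (hF.transfer hL.symm)
  refine ⟨?_, hrank⟩
  rcases lt_trichotomy (n l) (n' l') with h | h | h
  · exfalso
    exact fam_contra (n := n l) (by omega) oG (by omega) (show r ≤ n' l' - 2 by omega)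
      (by omega) hp ((fam_cyclic hg' (by omega)).transfer hL.symm) (by omega)
  · exact h
  · exfalso
    exact fam_contra (n := n' l') (by omega) oG' (by omega) (show r' ≤ n l - 2 by omega)
      (by omega) hp' ((fam_cyclic hg (by omega)).transfer hL) (by omega)
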